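/- arXiv:1708.05577 — 3 statements merged into one kernel-verified Lean document; each statement's English description precedes it below -/
import Mathlib

section
/- Let s ≥ 1 and let b_1, …, b_s ≥ 2 be pairwise coprime integers. For Lebesgue-almost every β > 0 the following holds: for every ε > 0 there exists a constant C = C(β, ε, b_1, …, b_s, s) > 0 such that for every integer N ≥ 2 the sequence x_n = (φ_{b_1}(⌊nβ⌋), …, φ_{b_s}(⌊nβ⌋)) ∈ [0,1)^s satisfies N · D_N(x_n) ≤ C · (log N)^{s+1+ε}. -/
open scoped Classical
open MeasureTheory

/-- Radical-inverse function in base `b`: `φ_b(m) = Σ_{j≥0} a_{j+1}(m) b^{-(j+1)}`,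
where `a_{j+1}(m) = (m / b^j) % b` is the `(j+1)`-st base-`b` digit of `m`. -/
noncomputable def radInv (b : ℕ) (m : ℕ) : ℝ :=
  ∑' j : ℕ, ((m / b ^ j % b : ℕ) : ℝ) / (b : ℝ) ^ (j + 1)

lemma card_fract_lt_le {α y ℓ : ℝ} (hℓ : 0 ≤ ℓ) {p : ℤ} {q : ℕ} (hq : 0 < q)
    (hpq : IsCoprime p (q : ℤ)) (h : |q * α - p| ≤ 1 / q) :
    (((Finset.range q).filter fun i : ℕ => Int.fract (i * α + y) < ℓ).card : ℝ) ≤ q * ℓ + 3 := by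
  have hq0 : (0 : ℝ) < q := by exact_mod_cast hq
  set Y : ℤ := ⌊q * y⌋
  let w : ℕ → ℤ := fun i => i * p + Y - q * ⌊i * α + y⌋
  have hmaps : Set.MapsTo w ((Finset.range q).filter fun i : ℕ => Int.fract (i * α + y) < ℓ)
      (Finset.Icc (-1) (⌊q * ℓ⌋ + 1) : Finset ℤ) := by
    intro i hi
    simp only [Finset.coe_filter, Finset.mem_range, Set.mem_ofPred_eq] at hi
    obtain ⟨hiq, hi⟩ := hi
    have hiq' : (i : ℝ) + 1 ≤ q := by exact_mod_cast hiq
    have h1 : |i * (q * α - p)| < 1 := by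
      rw [abs_mul, abs_of_nonneg (by positivity : (0 : ℝ) ≤ i)]
      calc (i : ℝ) * |q * α - p| ≤ i * (1 / q) := by gcongr
        _ < 1 := by rw [mul_one_div, div_lt_one hq0]; linarith
    rw [abs_lt] at h1
    have h2 := Int.floor_le (q * y)
    have h3 := Int.lt_floor_add_one (q * y)
    have h4 := Int.fract_nonneg (i * α + y)
    have h5 : Int.fract (i * α + y) = i * α + y - ⌊i * α + y⌋ := rfl
    have h6 : q * Int.fract (i * α + y) < q * ℓ := by gcongr
    have h7 : 0 ≤ q * Int.fract (i * α + y) := by positivity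
    have hw : (w i : ℝ) = i * p + Y - q * ⌊i * α + y⌋ := by simp [w]
    rw [Finset.coe_Icc, Set.mem_Icc]
    constructor
    · have : (-2 : ℝ) < w i := by rw [hw]; rw [h5] at h7; nlinarith
      have : (-2 : ℤ) < w i := by exact_mod_cast this
      omega
    · have : (w i : ℝ) - 1 ≤ q * ℓ := by rw [hw]; rw [h5] at h6; nlinarith
      have : w i - 1 ≤ ⌊q * ℓ⌋ := by rw [Int.le_floor]; push_cast; exact this
      omega
  have hinj : Set.InjOn w ((Finset.range q).filter fun i : ℕ => Int.fract (i * α + y) < ℓ) := by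
    intro i hi j hj hij
    simp only [Finset.coe_filter, Finset.mem_range, Set.mem_ofPred_eq] at hi hj
    have h1 : (q : ℤ) ∣ p * ((i : ℤ) - j) :=
      ⟨⌊i * α + y⌋ - ⌊j * α + y⌋, by simp only [w] at hij; linarith⟩
    have h2 : (q : ℤ) ∣ (i : ℤ) - j := hpq.symm.dvd_of_dvd_mul_left h1
    have h3 := Int.eq_zero_of_abs_lt_dvd h2 (by rw [abs_lt]; omega)
    omega
  have hcard := Finset.card_le_card_of_injOn w hmaps hinj
  rw [Int.card_Icc] at hcard
  have h0 : 0 ≤ ⌊q * ℓ⌋ := Int.floor_nonneg.2 (by positivity)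
  have h1 : (((Finset.range q).filter fun i : ℕ => Int.fract (i * α + y) < ℓ).card : ℤ)
      ≤ ⌊q * ℓ⌋ + 3 := by omega
  have h2 : (((Finset.range q).filter fun i : ℕ => Int.fract (i * α + y) < ℓ).card : ℝ)
      ≤ ⌊q * ℓ⌋ + 3 := by exact_mod_cast h1
  linarith [Int.floor_le (q * ℓ)]

/-- The local discrepancy of the Kronecker sequence `i α + y` on the interval `[0, ℓ)` mod one. -/
noncomputable def kroneckerDisc (α ℓ y : ℝ) (L : ℕ) : ℝ :=
  ∑ i ∈ Finset.range L, ((if Int.fract (i * α + y) < ℓ then 1 else 0) - ℓ)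

lemma kroneckerDisc_eq (α ℓ y : ℝ) (L : ℕ) :
    kroneckerDisc α ℓ y L =
      ((Finset.range L).filter fun i : ℕ => Int.fract (i * α + y) < ℓ).card - L * ℓ := by
  simp [kroneckerDisc, Finset.sum_sub_distrib]

lemma kroneckerDisc_add (α ℓ y : ℝ) (L M : ℕ) :
    kroneckerDisc α ℓ y (L + M) = kroneckerDisc α ℓ y L + kroneckerDisc α ℓ (L * α + y) M := by
  simp only [kroneckerDisc, Finset.sum_range_add, Nat.cast_add]
  congr 1
  refine Finset.sum_congr rfl fun i _ => ?_
  rw [show ((L : ℝ) + i) * α + y = i * α + (L * α + y) by ring]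

lemma abs_kroneckerDisc_le_three {α ℓ : ℝ} (hℓ : 0 ≤ ℓ) (hℓ1 : ℓ ≤ 1) {p : ℤ} {q : ℕ}
    (hq : 0 < q) (hpq : IsCoprime p (q : ℤ)) (h : |q * α - p| ≤ 1 / q) (y : ℝ) :
    |kroneckerDisc α ℓ y q| ≤ 3 := by
  rw [kroneckerDisc_eq, abs_le]
  have hu := card_fract_lt_le (y := y) hℓ hq hpq h
  have hl := card_fract_lt_le (y := y - ℓ) (sub_nonneg.2 hℓ1) hq hpq h
  have hsub : ((Finset.range q).filter fun i : ℕ => ¬ Int.fract (i * α + y) < ℓ) ⊆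
      (Finset.range q).filter fun i : ℕ => Int.fract (i * α + (y - ℓ)) < 1 - ℓ := by
    refine Finset.monotone_filter_right _ fun i _ hi => ?_
    have h1 := Int.fract_lt_one (i * α + y)
    have h2 : Int.fract (i * α + (y - ℓ)) = Int.fract (i * α + y) - ℓ := by
      rw [Int.fract_eq_iff]
      refine ⟨by linarith, by linarith, ⌊i * α + y⌋, ?_⟩
      rw [Int.fract]; ring
    rw [h2]; linarith
  have hc : ((((Finset.range q).filter fun i : ℕ => ¬ Int.fract (i * α + y) < ℓ)).card : ℝ) ≤ _ :=
    Nat.cast_le.2 (Finset.card_le_card hsub)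
  have htot : ((((Finset.range q).filter fun i : ℕ => Int.fract (i * α + y) < ℓ)).card : ℝ) +
      (((Finset.range q).filter fun i : ℕ => ¬ Int.fract (i * α + y) < ℓ)).card = q := by
    have := Finset.card_filter_add_card_filter_not (s := Finset.range q)
      (fun i : ℕ => Int.fract (i * α + y) < ℓ)
    rw [Finset.card_range] at this
    exact_mod_cast this
  constructor <;> linarith

lemma abs_kroneckerDisc_mul_add_le {α ℓ : ℝ} (hℓ : 0 ≤ ℓ) (hℓ1 : ℓ ≤ 1) {p : ℤ} {q : ℕ}
    (hq : 0 < q) (hpq : IsCoprime p (q : ℤ)) (h : |q * α - p| ≤ 1 / q) {r : ℕ} {D : ℝ}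
    (hD : ∀ y, |kroneckerDisc α ℓ y r| ≤ D) (c : ℕ) (y : ℝ) :
    |kroneckerDisc α ℓ y (q * c + r)| ≤ 3 * c + D := by
  induction c generalizing y with
  | zero => simpa using hD y
  | succ c ih =>
    rw [show q * (c + 1) + r = q + (q * c + r) by ring, kroneckerDisc_add]
    refine (abs_add_le _ _).trans ?_
    have h1 := abs_kroneckerDisc_le_three hℓ hℓ1 hq hpq h y
    have h2 := ih (q * α + y)
    push_cast
    linarith

lemma abs_kroneckerDisc_le_of_mul_le_two {α ℓ : ℝ} (hα : 0 < α) (hℓ : 0 ≤ ℓ) {L : ℕ}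
    (hL : L * α ≤ 2) (y : ℝ) : |kroneckerDisc α ℓ y L| ≤ 3 * (ℓ / α + 1) := by
  set S := (Finset.range L).filter fun i : ℕ => Int.fract (i * α + y) < ℓ with hS
  have himg : (S.image fun i : ℕ => ⌊i * α + y⌋) ⊆ Finset.Icc ⌊y⌋ (⌊y⌋ + 2) := by
    intro z hz
    obtain ⟨i, hi, rfl⟩ := Finset.mem_image.1 hz
    have hi' : (i : ℝ) + 1 ≤ L := by
      exact_mod_cast Finset.mem_range.1 (Finset.mem_filter.1 hi).1
    rw [Finset.mem_Icc]
    constructor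
    · exact Int.floor_mono (by nlinarith [(Nat.cast_nonneg i : (0 : ℝ) ≤ i)])
    · have : ⌊i * α + y⌋ < ⌊y⌋ + 3 := by
        rw [Int.floor_lt]; push_cast
        nlinarith [Int.lt_floor_add_one y]
      omega
  have hfib : ∀ z ∈ S.image fun i : ℕ => ⌊i * α + y⌋,
      (S.filter fun i : ℕ => ⌊i * α + y⌋ = z).card ≤ ⌈ℓ / α⌉₊ := by
    intro z _
    have hmaps : Set.MapsTo (fun i : ℕ => (i : ℤ)) (S.filter fun i : ℕ => ⌊i * α + y⌋ = z)
        (Finset.Ico ⌈(z - y) / α⌉ (⌈(z - y) / α⌉ + ⌈ℓ / α⌉) : Finset ℤ) := by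
      intro i hi
      simp only [S, Finset.coe_filter, Finset.mem_filter, Set.mem_ofPred_eq] at hi
      obtain ⟨⟨-, hi⟩, rfl⟩ := hi
      have h1 := Int.fract_nonneg (i * α + y)
      rw [Int.fract] at hi h1
      rw [Finset.coe_Ico, Set.mem_Ico]
      constructor
      · rw [Int.ceil_le, div_le_iff₀ hα]; push_cast; linarith
      · have h2 : (i : ℝ) < (⌊i * α + y⌋ - y) / α + ℓ / α := by
          rw [← add_div, lt_div_iff₀ hα]; linarith
        have h3 := Int.le_ceil ((⌊i * α + y⌋ - y) / α)
        have h4 := Int.le_ceil (ℓ / α)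
        have : ((i : ℤ) : ℝ) < ((⌈(⌊i * α + y⌋ - y) / α⌉ + ⌈ℓ / α⌉ : ℤ) : ℝ) := by
          push_cast; linarith
        exact_mod_cast this
    have := Finset.card_le_card_of_injOn _ hmaps (fun i _ j _ hij => by simpa using hij)
    rw [Int.card_Ico] at this
    have hcc : ((⌈ℓ / α⌉₊ : ℤ)) = ⌈ℓ / α⌉ := Int.natCast_ceil_eq_ceil (by positivity)
    omega
  have h1 := Finset.card_le_mul_card_image S _ hfib
  have h2 := Finset.card_le_card himg
  rw [Int.card_Icc] at h2
  have h3 : S.card ≤ ⌈ℓ / α⌉₊ * 3 := h1.trans (Nat.mul_le_mul_left _ (by omega))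
  have h4 : (S.card : ℝ) ≤ ⌈ℓ / α⌉₊ * 3 := by exact_mod_cast h3
  have h5 := Nat.ceil_lt_add_one (show 0 ≤ ℓ / α by positivity)
  have h6 : L * ℓ ≤ 2 * (ℓ / α) := by
    rw [mul_div_assoc', le_div_iff₀ hα]; nlinarith
  have h7 : (0 : ℝ) ≤ S.card := by positivity
  have h8 : (0 : ℝ) ≤ L * ℓ := by positivity
  have h9 : 0 ≤ ℓ / α := by positivity
  rw [kroneckerDisc_eq, ← hS, abs_le]
  constructor <;> linarith

/-- The bound for `kroneckerDisc` on lengths below `2 ^ K` by partial quotients `a k` at the scales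
`2 ^ k`. -/
lemma exists_abs_kroneckerDisc_le {α : ℝ} (hα : 0 < α) :
    ∃ a : ℕ → ℝ, (∀ k, 0 ≤ a k) ∧
      (∀ k, a k = 0 ∨ ∃ q ∈ (Finset.Icc 1 (2 ^ k) : Finset ℕ), (∃ p : ℤ, 1 ≤ p ∧
        |q * α - p| ≤ 1 / (2 ^ k + 1)) ∧ a k = 2 ^ k / q) ∧
      ∀ ℓ : ℝ, 0 ≤ ℓ → ℓ ≤ 1 → ∀ K L : ℕ, L < 2 ^ K → ∀ y,
        |kroneckerDisc α ℓ y L| ≤ 3 * (ℓ / α + 1) + 6 * ∑ k ∈ Finset.range K, a k := by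
  have hex : ∃ k : ℕ, 1 ≤ 2 ^ k * α := by
    obtain ⟨k, hk⟩ := pow_unbounded_of_one_lt (1 / α) (one_lt_two)
    exact ⟨k, by rw [div_lt_iff₀ hα] at hk; exact hk.le⟩
  set k₀ := Nat.find hex with hk₀
  have hk₀1 : 1 ≤ 2 ^ k₀ * α := Nat.find_spec hex
  have hdir : ∀ k : ℕ, ∃ (p : ℤ) (q : ℕ), 0 < q ∧ q ≤ 2 ^ k ∧ IsCoprime p (q : ℤ) ∧
      |q * α - p| ≤ 1 / (2 ^ k + 1) := by
    intro k
    obtain ⟨x, hx, hxk⟩ := Real.exists_rat_abs_sub_le_and_den_le α (n := 2 ^ k) (by positivity)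
    have hx0 : (0 : ℝ) < x.den := by exact_mod_cast x.den_pos
    refine ⟨x.num, x.den, x.den_pos, hxk, ?_, ?_⟩
    · rw [Int.isCoprime_iff_gcd_eq_one]
      exact x.reduced
    · have h1 : (x.den : ℝ) * α - x.num = x.den * (α - x) := by
        have : (x : ℝ) = x.num / x.den := Rat.cast_def x
        rw [this]; field_simp
      rw [h1, abs_mul, abs_of_pos hx0]
      calc (x.den : ℝ) * |α - x| ≤ x.den * (1 / (((2 ^ k : ℕ) + 1) * x.den)) := by gcongr
        _ = 1 / (2 ^ k + 1) := by push_cast; field_simp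
  choose p q hq0 hqk hcop hpq using hdir
  have ha0 : ∀ k, 0 ≤ if k₀ ≤ k then (2 : ℝ) ^ k / q k else 0 := fun k => by
    split_ifs <;> positivity
  refine ⟨fun k => if k₀ ≤ k then 2 ^ k / q k else 0, ha0, fun k => ?_, fun ℓ hℓ hℓ1 => ?_⟩
  · by_cases hk : k₀ ≤ k
    · refine Or.inr ⟨q k, Finset.mem_Icc.2 ⟨hq0 k, hqk k⟩, ⟨p k, ?_, hpq k⟩, if_pos hk⟩
      have h1 : (1 : ℝ) ≤ q k := by exact_mod_cast hq0 k
      have h2 : (2 : ℝ) ^ k₀ ≤ 2 ^ k := pow_le_pow_right₀ one_le_two hk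
      have h3 : 1 / ((2 : ℝ) ^ k + 1) < α := by
        rw [div_lt_iff₀ (by positivity)]; nlinarith
      have h4 := (abs_le.1 (hpq k)).2
      have h5 : (0 : ℝ) < p k := by nlinarith
      exact_mod_cast h5
    · exact Or.inl (if_neg hk)
  · have hbase : ∀ L : ℕ, L < 2 ^ k₀ → ∀ y, |kroneckerDisc α ℓ y L| ≤ 3 * (ℓ / α + 1) := by
      intro L hL y
      refine abs_kroneckerDisc_le_of_mul_le_two hα hℓ ?_ y
      rcases Nat.eq_zero_or_pos k₀ with h0 | h0
      · have : L = 0 := by rw [h0] at hL; omega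
        simp [this]
      · have h1 := Nat.find_min hex (m := k₀ - 1) (by omega)
        have h2 : (2 : ℝ) ^ k₀ = 2 * 2 ^ (k₀ - 1) := by
          rw [← pow_succ']; congr 1; omega
        have h3 : (L : ℝ) ≤ 2 ^ k₀ := by exact_mod_cast hL.le
        nlinarith
    intro K
    induction K with
    | zero =>
      intro L hL y
      have : L = 0 := by simpa using hL
      simp only [this, Finset.range_zero, Finset.sum_empty, kroneckerDisc, abs_zero]
      positivity
    | succ K ih =>
      intro L hL y
      by_cases hK : k₀ ≤ K
      · rw [Finset.sum_range_succ, if_pos hK]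
        have h1 : (q K : ℝ) ≤ 2 ^ K := by exact_mod_cast hqk K
        have h2 : (0 : ℝ) < q K := by exact_mod_cast hq0 K
        have h3 : |q K * α - p K| ≤ 1 / q K := (hpq K).trans
          (one_div_le_one_div_of_le h2 (by linarith))
        have h4 := abs_kroneckerDisc_mul_add_le hℓ hℓ1 (hq0 K) (hcop K) h3
          (ih (L % q K) ((Nat.mod_lt _ (hq0 K)).trans_le (hqk K))) (L / q K) y
        rw [Nat.div_add_mod] at h4
        have h5 : ((L / q K : ℕ) : ℝ) ≤ 2 * (2 ^ K / q K) := by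
          refine Nat.cast_div_le.trans ?_
          rw [mul_div_assoc']
          gcongr
          rw [← pow_succ']
          exact_mod_cast hL.le
        linarith
      · have h1 : 2 ^ (K + 1) ≤ 2 ^ k₀ := Nat.pow_le_pow_right two_pos (by omega)
        have h2 := hbase L (hL.trans_le h1) y
        have h3 : 0 ≤ ∑ k ∈ Finset.range (K + 1), if k₀ ≤ k then (2 : ℝ) ^ k / q k else 0 :=
          Finset.sum_nonneg fun k _ => ha0 k
        linarith

lemma floor_mul_toNat_mod_eq_iff {β : ℝ} (hβ : 0 < β) {B r : ℕ} (hr : r < B) (n : ℕ) :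
    ⌊(n : ℝ) * β⌋.toNat % B = r ↔ Int.fract (n * (β / B) + -(r / B : ℝ)) < 1 / B := by
  have hB : (0 : ℝ) < B := by exact_mod_cast (Nat.zero_le r).trans_lt hr
  have hfl : (0 : ℤ) ≤ ⌊(n : ℝ) * β⌋ := Int.floor_nonneg.2 (by positivity)
  set m := ⌊(n : ℝ) * β⌋.toNat with hm
  have hmz : ((m : ℤ)) = ⌊(n : ℝ) * β⌋ := Int.toNat_of_nonneg hfl
  have hmr : (m : ℝ) = (⌊(n : ℝ) * β⌋ : ℝ) := by exact_mod_cast congrArg (Int.cast (R := ℝ)) hmz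
  have hlo := Int.floor_le ((n : ℝ) * β)
  have hhi := Int.lt_floor_add_one ((n : ℝ) * β)
  rw [← hmr] at hlo hhi
  have ht : (n : ℝ) * (β / B) + -(r / B : ℝ) = (n * β - r) / B := by ring
  rw [ht]
  constructor
  · intro h
    have hdm : (m : ℝ) = B * ((m / B : ℕ) : ℝ) + r := by
      have := Nat.div_add_mod m B
      rw [h] at this
      exact_mod_cast this.symm
    have h1 : Int.fract ((n * β - r) / B) = (n * β - m) / B := by
      rw [Int.fract_eq_iff]
      refine ⟨div_nonneg (by linarith) hB.le, ?_, ((m / B : ℕ) : ℤ), ?_⟩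
      · rw [div_lt_one hB]
        have : (1 : ℝ) ≤ B := by exact_mod_cast (Nat.zero_le r).trans_lt hr
        linarith
      · rw [Int.cast_natCast, hdm]; field_simp; ring
    rw [h1]
    gcongr
    linarith
  · intro h
    set z := ⌊(n * β - r) / B⌋ with hz
    have h0 := Int.fract_nonneg ((n * β - r) / B)
    rw [Int.fract, ← hz] at h h0
    have h1 : 0 ≤ n * β - r - B * z := by
      have := mul_nonneg hB.le h0
      rw [mul_sub, mul_div_cancel₀ _ hB.ne'] at this
      exact this
    have h2 : n * β - r - B * z < 1 := by
      have := mul_lt_mul_of_pos_left h hB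
      rw [mul_sub, mul_div_cancel₀ _ hB.ne', mul_one_div_cancel hB.ne'] at this
      exact this
    have h3 : ⌊(n : ℝ) * β⌋ = r + B * z := by
      rw [Int.floor_eq_iff]; push_cast; constructor <;> linarith
    have h4 : ((m % B : ℕ) : ℤ) = r := by
      rw [Int.natCast_mod, hmz, h3, Int.add_mul_emod_self_left]
      exact Int.emod_eq_of_lt (by positivity) (by exact_mod_cast hr)
    exact_mod_cast h4

lemma abs_sum_mod_eq_sub_le {β : ℝ} (hβ : 0 < β) (B : ℕ) (hB : 0 < B) :
    ∃ a : ℕ → ℝ, (∀ k, 0 ≤ a k) ∧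
      (∀ k, a k = 0 ∨ ∃ q ∈ (Finset.Icc 1 (2 ^ k) : Finset ℕ), (∃ p : ℤ, 1 ≤ p ∧
        |q * (β / B) - p| ≤ 1 / (2 ^ k + 1)) ∧ a k = 2 ^ k / q) ∧
      ∀ K N : ℕ, N < 2 ^ K → ∀ r < B,
        |∑ n ∈ Finset.range N, ((if ⌊(n : ℝ) * β⌋.toNat % B = r then (1 : ℝ) else 0) - 1 / B)|
          ≤ 3 * (1 / β + 1) + 6 * ∑ k ∈ Finset.range K, a k := by
  have hB' : (0 : ℝ) < B := by exact_mod_cast hB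
  obtain ⟨a, ha0, ha, h⟩ := exists_abs_kroneckerDisc_le (div_pos hβ hB')
  refine ⟨a, ha0, ha, fun K N hN r hr => ?_⟩
  have h1 := h (1 / B) (by positivity) (by rw [div_le_one hB']; exact_mod_cast hB) K N hN (-(r / B))
  rw [div_div_div_cancel_right₀ hB'.ne'] at h1
  simpa only [kroneckerDisc, floor_mul_toNat_mod_eq_iff hβ hr] using h1

/-- The number whose base-`b` digits are the first `J` digits of `m` in reversed order. -/
def digitRev (b : ℕ) : ℕ → ℕ → ℕ
  | 0, _ => 0
  | J + 1, m => b * digitRev b J m + m / b ^ J % b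

lemma digitRev_div_eq_sum {b : ℕ} (hb : 2 ≤ b) (J m : ℕ) :
    (digitRev b J m : ℝ) / b ^ J =
      ∑ j ∈ Finset.range J, ((m / b ^ j % b : ℕ) : ℝ) / (b : ℝ) ^ (j + 1) := by
  have hb0 : (b : ℝ) ≠ 0 := by positivity
  induction J with
  | zero => simp [digitRev]
  | succ J ih =>
    rw [Finset.sum_range_succ, ← ih, digitRev, Nat.cast_add, Nat.cast_mul]
    field_simp
    ring

lemma radInv_term_le {b : ℕ} (hb : 2 ≤ b) (m j : ℕ) :
    ((m / b ^ j % b : ℕ) : ℝ) / (b : ℝ) ^ (j + 1) ≤ 1 / b ^ j - 1 / b ^ (j + 1) := by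
  have hb0 : (0 : ℝ) < b := by positivity
  have h1 : ((m / b ^ j % b : ℕ) : ℝ) + 1 ≤ b := by
    exact_mod_cast Nat.mod_lt _ (by omega : 0 < b)
  have h2 : (1 : ℝ) / b ^ j - 1 / b ^ (j + 1) = (b - 1) / b ^ (j + 1) := by
    field_simp
    ring
  rw [h2]
  gcongr
  linarith

lemma sum_radInv_term_Ico_le {b : ℕ} (hb : 2 ≤ b) (m J n : ℕ) :
    ∑ j ∈ Finset.range n, ((m / b ^ (j + J) % b : ℕ) : ℝ) / (b : ℝ) ^ (j + J + 1) ≤ 1 / b ^ J := by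
  have h : ∑ j ∈ Finset.range n, ((m / b ^ (j + J) % b : ℕ) : ℝ) / (b : ℝ) ^ (j + J + 1) ≤
      1 / b ^ J - 1 / b ^ (n + J) := by
    induction n with
    | zero => simp
    | succ n ih =>
      rw [Finset.sum_range_succ]
      have := radInv_term_le hb m (n + J)
      rw [show n + 1 + J = n + J + 1 by ring]
      linarith
  have : (0 : ℝ) ≤ 1 / b ^ (n + J) := by positivity
  linarith

lemma summable_radInv {b : ℕ} (hb : 2 ≤ b) (m : ℕ) :
    Summable fun j : ℕ => ((m / b ^ j % b : ℕ) : ℝ) / (b : ℝ) ^ (j + 1) :=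
  summable_of_sum_range_le (fun j => by positivity)
    (fun n => by simpa using sum_radInv_term_Ico_le hb m 0 n)

lemma digitRev_div_le_radInv {b : ℕ} (hb : 2 ≤ b) (J m : ℕ) :
    (digitRev b J m : ℝ) / b ^ J ≤ radInv b m := by
  rw [digitRev_div_eq_sum hb, radInv]
  exact (summable_radInv hb m).sum_le_tsum _ fun j _ => by positivity

lemma radInv_le_digitRev_add_one_div {b : ℕ} (hb : 2 ≤ b) (J m : ℕ) :
    radInv b m ≤ ((digitRev b J m : ℝ) + 1) / b ^ J := by
  rw [add_div, digitRev_div_eq_sum hb, radInv, ← (summable_radInv hb m).sum_add_tsum_nat_add J]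
  gcongr
  exact Real.tsum_le_of_sum_range_le (fun j => by positivity) (sum_radInv_term_Ico_le hb m J)

lemma digitRev_eq_iff_exists_mod {b : ℕ} (hb : 2 ≤ b) (J : ℕ) : ∀ x < b ^ J,
    ∃ r < b ^ J, ∀ m, digitRev b J m = x ↔ m % b ^ J = r := by
  induction J with
  | zero => intro x hx; exact ⟨0, by simp, fun m => by simp at hx; simp [digitRev, hx, Nat.mod_one]⟩
  | succ J ih =>
    intro x hx
    have hb0 : 0 < b := by omega
    obtain ⟨r, hr, h⟩ := ih (x / b) (by rw [Nat.div_lt_iff_lt_mul hb0, ← pow_succ]; exact hx)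
    have hd := Nat.mod_lt x hb0
    refine ⟨r + b ^ J * (x % b), ?_, fun m => ?_⟩
    · rw [pow_succ]; nlinarith
    · have hpos : 0 < b ^ J := by positivity
      have e := Nat.mod_lt (m / b ^ J) hb0
      have e' := Nat.mod_lt m hpos
      rw [Nat.mod_pow_succ, digitRev]
      constructor
      · rintro rfl
        have h1 : (b * digitRev b J m + m / b ^ J % b) / b = digitRev b J m := by
          rw [Nat.mul_add_div hb0, Nat.div_eq_of_lt e, add_zero]
        rw [h1] at h
        rw [(h m).1 rfl, Nat.mul_add_mod, Nat.mod_eq_of_lt e]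
      · intro hm
        have h1 := congrArg (· % b ^ J) hm
        have h2 := congrArg (· / b ^ J) hm
        simp only [Nat.add_mul_mod_self_left, Nat.mod_eq_of_lt e', Nat.mod_eq_of_lt hr,
          Nat.add_mul_div_left _ _ hpos, Nat.div_eq_of_lt e', Nat.div_eq_of_lt hr, zero_add]
          at h1 h2
        rw [(h m).2 h1, h2, Nat.div_add_mod]

/-- `f` is a combination of indicators of residue classes modulo `b ^ j`, `j ≤ J`, with at most
`w` classes at each level and coefficients in `[-1, 1]`; `μ` is its mean value. -/
def IsAdicComb (b J w : ℕ) (f : ℕ → ℝ) (μ : ℝ) : Prop :=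
  ∃ (c : ℕ → ℕ → ℝ) (r : ℕ → ℕ → ℕ), (∀ j d, |c j d| ≤ 1) ∧ (∀ j d, r j d < b ^ j) ∧
    (∀ m, f m = ∑ j ∈ Finset.range (J + 1), ∑ d ∈ Finset.range w,
      c j d * if m % b ^ j = r j d then 1 else 0) ∧
    μ = ∑ j ∈ Finset.range (J + 1), ∑ d ∈ Finset.range w, c j d / b ^ j

lemma IsAdicComb.sub {b J w w' : ℕ} {f g : ℕ → ℝ} {μ ν : ℝ} (hf : IsAdicComb b J w f μ)
    (hg : IsAdicComb b J w' g ν) : IsAdicComb b J (w + w') (fun m => f m - g m) (μ - ν) := by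
  obtain ⟨c, r, hc, hr, hf, hμ⟩ := hf
  obtain ⟨c', r', hc', hr', hg, hν⟩ := hg
  refine ⟨fun j d => if d < w then c j d else -c' j (d - w),
    fun j d => if d < w then r j d else r' j (d - w), fun j d => ?_, fun j d => ?_, fun m => ?_, ?_⟩
  · dsimp only
    split_ifs
    · exact hc _ _
    · rw [abs_neg]; exact hc' _ _
  · dsimp only
    split_ifs
    · exact hr _ _
    · exact hr' _ _
  · dsimp only
    rw [hf, hg, ← Finset.sum_sub_distrib]
    refine Finset.sum_congr rfl fun j _ => ?_
    rw [Finset.sum_range_add, sub_eq_add_neg, ← Finset.sum_neg_distrib]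
    congr 1 <;> refine Finset.sum_congr rfl fun d hd => ?_
    · simp [Finset.mem_range.1 hd]
    · simp only [Nat.not_lt.2 (Nat.le_add_right w d), if_false, Nat.add_sub_cancel_left, neg_mul]
  · rw [hμ, hν, ← Finset.sum_sub_distrib]
    refine Finset.sum_congr rfl fun j _ => ?_
    rw [Finset.sum_range_add, sub_eq_add_neg, ← Finset.sum_neg_distrib]
    congr 1 <;> refine Finset.sum_congr rfl fun d hd => ?_
    · simp [Finset.mem_range.1 hd]
    · simp [neg_div]

lemma isAdicComb_digitRev_lt {b : ℕ} (hb : 2 ≤ b) (J : ℕ) : ∀ C ≤ b ^ J,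
    IsAdicComb b J b (fun m => if digitRev b J m < C then 1 else 0) (C / b ^ J) := by
  have hb0 : 0 < b := by omega
  induction J with
  | zero =>
    intro C hC
    refine ⟨fun _ d => if d = 0 then C else 0, fun _ _ => 0, fun j d => ?_, fun j d => by positivity,
      fun m => ?_, ?_⟩
    · have : (C : ℝ) ≤ 1 := by exact_mod_cast hC
      dsimp only
      split_ifs <;> simp [this]
    · have : C = 0 ∨ C = 1 := by simp at hC; omega
      simp only [zero_add, Finset.sum_range_one, pow_zero, Nat.mod_one, if_true]
      rcases this with rfl | rfl <;> simp [digitRev, hb0]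
    · simp [hb0, ite_div]
  | succ J ih =>
    intro C hC
    have hC' : C / b ≤ b ^ J := by
      rw [Nat.div_le_iff_le_mul_add_pred hb0]
      rw [pow_succ'] at hC; omega
    obtain ⟨c, r, hc, hr, h, hμ⟩ := ih (C / b) hC'
    have hex : ∀ d, ∃ r' < b ^ (J + 1), d < C % b →
        ∀ m, digitRev b (J + 1) m = b * (C / b) + d ↔ m % b ^ (J + 1) = r' := by
      intro d
      by_cases hd : d < C % b
      · have hlt : b * (C / b) + d < b ^ (J + 1) := by
          have := Nat.div_add_mod C b
          omega
        obtain ⟨r', h1, h2⟩ := digitRev_eq_iff_exists_mod hb (J + 1) _ hlt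
        exact ⟨r', h1, fun _ => h2⟩
      · exact ⟨0, by positivity, fun h => absurd h hd⟩
    choose r' hr' hrr using hex
    refine ⟨fun j d => if j < J + 1 then c j d else if d < C % b then 1 else 0,
      fun j d => if j < J + 1 then r j d else if j = J + 1 then r' d else 0, fun j d => ?_,
      fun j d => ?_, fun m => ?_, ?_⟩
    · dsimp only
      split_ifs
      · exact hc _ _
      all_goals simp
    · dsimp only
      split_ifs with h1 h2
      · exact hr _ _
      · rw [h2]; exact hr' d
      · positivity
    · rw [Finset.sum_range_succ]
      have h1 : ∑ j ∈ Finset.range (J + 1), ∑ d ∈ Finset.range b,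
          (if j < J + 1 then c j d else if d < C % b then 1 else 0) *
            (if m % b ^ j = (if j < J + 1 then r j d else if j = J + 1 then r' d else 0)
              then (1 : ℝ) else 0) = if digitRev b J m < C / b then 1 else 0 := by
        refine Eq.trans ?_ (h m).symm
        refine Finset.sum_congr rfl fun j hj => Finset.sum_congr rfl fun d _ => ?_
        simp only [if_pos (Finset.mem_range.1 hj)]
      rw [h1]
      simp only [lt_irrefl, if_false, if_true]
      have h2 : ∀ d ∈ Finset.range b, ((if d < C % b then (1 : ℝ) else 0) *
          if m % b ^ (J + 1) = r' d then 1 else 0) =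
          if d = m / b ^ J % b then
            (if digitRev b J m = C / b ∧ m / b ^ J % b < C % b then 1 else 0) else 0 := by
        intro d hd
        have hd' := Finset.mem_range.1 hd
        have e := Nat.mod_lt (m / b ^ J) hb0
        by_cases hdC : d < C % b
        · rw [if_pos hdC, one_mul]
          have h3 : m % b ^ (J + 1) = r' d ↔ digitRev b J m = C / b ∧ d = m / b ^ J % b := by
            rw [← hrr d hdC m, digitRev]
            constructor
            · intro h4
              have h5 := congrArg (· / b) h4
              have h6 := congrArg (· % b) h4
              simp only [Nat.mul_add_div hb0, Nat.div_eq_of_lt e, Nat.div_eq_of_lt hd', add_zero,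
                Nat.mul_add_mod, Nat.mod_eq_of_lt e, Nat.mod_eq_of_lt hd'] at h5 h6
              exact ⟨h5, h6.symm⟩
            · rintro ⟨h5, h6⟩; rw [h5, ← h6]
          simp only [h3]
          by_cases h4 : d = m / b ^ J % b
          · rw [← h4]; simp [hdC]
          · simp [h4]
        · rw [if_neg hdC, zero_mul]
          split_ifs with h3 h4
          · exact absurd (h3 ▸ h4.2) hdC
          · rfl
          · rfl
      rw [Finset.sum_congr rfl h2, Finset.sum_ite_eq', if_pos (Finset.mem_range.2
        (Nat.mod_lt _ hb0)), digitRev]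
      have e := Nat.mod_lt (m / b ^ J) hb0
      have e' := Nat.mod_lt C hb0
      have hdm := Nat.div_add_mod C b
      generalize digitRev b J m = x at *
      generalize m / b ^ J % b = y at *
      rcases lt_trichotomy x (C / b) with hx | hx | hx
      · have : b * x + y < C := by
          have := Nat.mul_le_mul_left b (Nat.succ_le_of_lt hx)
          rw [Nat.mul_succ] at this
          omega
        simp [hx, hx.ne, this]
      · have : b * x + y < C ↔ y < C % b := by rw [hx]; omega
        simp only [this]
        simp [hx]
      · have : ¬ b * x + y < C := by
          have := Nat.mul_le_mul_left b (Nat.succ_le_of_lt hx)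
          rw [Nat.mul_succ] at this
          omega
        simp [hx.not_gt, hx.ne', this]
    · rw [Finset.sum_range_succ]
      have h1 : ∑ j ∈ Finset.range (J + 1), ∑ d ∈ Finset.range b,
          (if j < J + 1 then c j d else if d < C % b then 1 else 0) / (b : ℝ) ^ j =
          ((C / b : ℕ) : ℝ) / b ^ J := by
        rw [hμ]
        refine Finset.sum_congr rfl fun j hj => Finset.sum_congr rfl fun d _ => ?_
        simp only [if_pos (Finset.mem_range.1 hj)]
      rw [h1]
      simp only [lt_irrefl, if_false]
      have h2 : ∑ d ∈ Finset.range b, (if d < C % b then (1 : ℝ) else 0) / (b : ℝ) ^ (J + 1) =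
          (C % b : ℕ) / (b : ℝ) ^ (J + 1) := by
        rw [← Finset.sum_div, Finset.sum_boole]
        congr 3
        have e' := Nat.mod_lt C hb0
        rw [show (Finset.range b).filter (fun d => d < C % b) = Finset.range (C % b) by
          ext; simp; omega, Finset.card_range]
      rw [h2]
      have hdm : (C : ℝ) = b * ((C / b : ℕ) : ℝ) + (C % b : ℕ) := by
        exact_mod_cast (Nat.div_add_mod C b).symm
      have hb0' : (b : ℝ) ≠ 0 := by positivity
      rw [hdm]
      field_simp
      ring

lemma isAdicComb_digitRev_mem_Ico {b : ℕ} (hb : 2 ≤ b) (J A C : ℕ) (hAC : A ≤ C) (hC : C ≤ b ^ J) :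
    IsAdicComb b J (b + b) (fun m => if digitRev b J m ∈ Set.Ico A C then 1 else 0)
      (((C : ℝ) - A) / b ^ J) := by
  rw [sub_div]
  convert (isAdicComb_digitRev_lt hb J C hC).sub (isAdicComb_digitRev_lt hb J A (hAC.trans hC))
    using 2 with m
  simp only [Set.mem_Ico]
  split_ifs <;> first | omega | simp

lemma exists_forall_mod_eq_iff {ι : Type*} [Fintype ι] {B : ι → ℕ} (hB : ∀ i, 0 < B i)
    (hcop : Pairwise fun i j => Nat.Coprime (B i) (B j)) (r : ι → ℕ) (hr : ∀ i, r i < B i) :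
    ∃ r₀ < ∏ i, B i, ∀ m, (∀ i, m % B i = r i) ↔ m % ∏ i, B i = r₀ := by
  have hpp : Set.Pairwise ((Finset.univ : Finset ι) : Set ι) (Function.onFun Nat.Coprime B) :=
    fun i _ j _ hij => hcop hij
  let k := Nat.chineseRemainderOfFinset r B Finset.univ (fun i _ => (hB i).ne') hpp
  have hk : (k : ℕ) < ∏ i, B i :=
    Nat.chineseRemainderOfFinset_lt_prod r B (fun i _ => (hB i).ne') hpp
  refine ⟨k, hk, fun m => ⟨fun h => ?_, fun h i => ?_⟩⟩
  · have h1 : ∀ i ∈ Finset.univ, (B i : ℤ) ∣ (k : ℕ) - (m : ℤ) := by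
      intro i hi
      rw [← Nat.modEq_iff_dvd]
      have h2 := k.2 i hi
      rw [Nat.ModEq, Nat.mod_eq_of_lt (hr i)] at h2
      rw [Nat.ModEq, h2, h i]
    have h3 := Finset.prod_dvd_of_coprime
      (fun i hi j hj hij => Nat.isCoprime_iff_coprime.2 (hpp hi hj hij)) h1
    have h4 : m ≡ k [MOD ∏ i, B i] := by
      rw [Nat.modEq_iff_dvd]; push_cast; exact h3
    rw [Nat.ModEq, Nat.mod_eq_of_lt hk] at h4
    exact h4
  · have h1 : m ≡ k [MOD ∏ i, B i] := by rw [Nat.ModEq, h, Nat.mod_eq_of_lt hk]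
    have h2 := (h1.of_dvd (Finset.dvd_prod_of_mem B (Finset.mem_univ i))).trans
      (k.2 i (Finset.mem_univ i))
    rwa [Nat.ModEq, Nat.mod_eq_of_lt (hr i)] at h2

lemma abs_sum_prod_sub_le {s : ℕ} {b : Fin s → ℕ} (hb : ∀ i, 2 ≤ b i)
    (hcop : ∀ i j, i ≠ j → Nat.Coprime (b i) (b j)) {J : ℕ} {w : Fin s → ℕ} {f : Fin s → ℕ → ℝ}
    {μ : Fin s → ℝ} (h : ∀ i, IsAdicComb (b i) J (w i) (f i) (μ i)) (M : ℕ → ℕ) (N : ℕ)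
    (e : (Fin s → ℕ) → ℝ)
    (he : ∀ j : Fin s → ℕ, ∀ r < ∏ i, b i ^ j i, |∑ n ∈ Finset.range N,
      ((if M n % ∏ i, b i ^ j i = r then (1 : ℝ) else 0) - 1 / (∏ i, b i ^ j i : ℕ))| ≤ e j) :
    |∑ n ∈ Finset.range N, ∏ i, f i (M n) - N * ∏ i, μ i| ≤
      (∏ i, w i : ℕ) * ∑ j ∈ Fintype.piFinset fun _ : Fin s => Finset.range (J + 1), e j := by
  choose c r hc hr hf hμ using h
  have hcrt : ∀ j d : Fin s → ℕ, ∃ r₀ < ∏ i, b i ^ j i,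
      ∀ m, (∀ i, m % b i ^ j i = r i (j i) (d i)) ↔ m % ∏ i, b i ^ j i = r₀ := fun j d =>
    exists_forall_mod_eq_iff (fun i => pow_pos (by have := hb i; omega) _)
      (fun i i' hii => (hcop i i' hii).pow _ _) _ fun i => hr i _ _
  choose R hR hRm using hcrt
  have hprod : ∀ m, ∏ i, f i m =
      ∑ j ∈ Fintype.piFinset fun _ : Fin s => Finset.range (J + 1),
        ∑ d ∈ Fintype.piFinset fun i => Finset.range (w i),
          (∏ i, c i (j i) (d i)) * if m % ∏ i, b i ^ j i = R j d then 1 else 0 := by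
    intro m
    simp_rw [hf, Finset.prod_univ_sum, Finset.prod_mul_distrib, Finset.prod_boole,
      Finset.mem_univ, true_implies, hRm]
  have hμprod : ∏ i, μ i =
      ∑ j ∈ Fintype.piFinset fun _ : Fin s => Finset.range (J + 1),
        ∑ d ∈ Fintype.piFinset fun i => Finset.range (w i),
          (∏ i, c i (j i) (d i)) * (1 / (∏ i, b i ^ j i : ℕ)) := by
    simp_rw [hμ, Finset.prod_univ_sum, Finset.prod_div_distrib]
    push_cast
    simp_rw [mul_one_div]
  have hmain : ∑ n ∈ Finset.range N, ∏ i, f i (M n) - N * ∏ i, μ i =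
      ∑ j ∈ Fintype.piFinset fun _ : Fin s => Finset.range (J + 1),
        ∑ d ∈ Fintype.piFinset fun i => Finset.range (w i),
          (∏ i, c i (j i) (d i)) * ∑ n ∈ Finset.range N,
            ((if M n % ∏ i, b i ^ j i = R j d then (1 : ℝ) else 0) - 1 / (∏ i, b i ^ j i : ℕ)) := by
    have h1 : (N : ℝ) * ∏ i, μ i = ∑ n ∈ Finset.range N, ∏ i, μ i := by simp
    rw [h1, ← Finset.sum_sub_distrib]
    simp_rw [hprod, hμprod, ← Finset.sum_sub_distrib, ← mul_sub]
    rw [Finset.sum_comm]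
    refine Finset.sum_congr rfl fun j _ => ?_
    rw [Finset.sum_comm]
    simp_rw [Finset.mul_sum]
  rw [hmain, Finset.mul_sum]
  refine (Finset.abs_sum_le_sum_abs _ _).trans (Finset.sum_le_sum fun j _ => ?_)
  refine (Finset.abs_sum_le_sum_abs _ _).trans ?_
  refine (Finset.sum_le_card_nsmul _ _ (e j) fun d _ => ?_).trans ?_
  · rw [abs_mul, Finset.abs_prod]
    calc _ ≤ 1 * e j := by
          gcongr
          · exact Finset.prod_le_one (fun i _ => abs_nonneg _) fun i _ => hc i _ _
          · exact he j _ (hR j d)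
      _ = e j := one_mul _
  · rw [nsmul_eq_mul, Fintype.card_piFinset]
    simp

lemma abs_prod_sub_prod_le_sum {ι : Type*} (t : Finset ι) {x y : ι → ℝ}
    (hx : ∀ i, 0 ≤ x i ∧ x i ≤ 1) (hy : ∀ i, 0 ≤ y i ∧ y i ≤ 1) :
    |∏ i ∈ t, x i - ∏ i ∈ t, y i| ≤ ∑ i ∈ t, |x i - y i| := by
  induction t using Finset.induction_on with
  | empty => simp
  | insert a t ha ih =>
    rw [Finset.prod_insert ha, Finset.prod_insert ha, Finset.sum_insert ha,
      show x a * ∏ i ∈ t, x i - y a * ∏ i ∈ t, y i =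
        (x a - y a) * ∏ i ∈ t, x i + y a * (∏ i ∈ t, x i - ∏ i ∈ t, y i) by ring]
    refine (abs_add_le _ _).trans (add_le_add ?_ ?_)
    · rw [abs_mul]
      refine mul_le_of_le_one_right (abs_nonneg _) ?_
      rw [Finset.abs_prod]
      exact Finset.prod_le_one (fun i _ => abs_nonneg _) fun i _ => by
        rw [abs_of_nonneg (hx i).1]; exact (hx i).2
    · rw [abs_mul, abs_of_nonneg (hy a).1]
      exact (mul_le_of_le_one_left (abs_nonneg _) (hy a).2).trans ih

lemma abs_card_radInv_mem_sub_le {s : ℕ} {b : Fin s → ℕ} (hb : ∀ i, 2 ≤ b i) (M : ℕ → ℕ)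
    {J N : ℕ} (hN : ∀ i, N ≤ b i ^ J) {T : ℝ}
    (hT : ∀ A C : Fin s → ℕ, (∀ i, A i ≤ C i) → (∀ i, C i ≤ b i ^ J) →
      |∑ n ∈ Finset.range N, ∏ i, (if digitRev (b i) J (M n) ∈ Set.Ico (A i) (C i) then (1 : ℝ)
        else 0) - N * ∏ i, (((C i : ℝ) - A i) / b i ^ J)| ≤ T)
    {u v : Fin s → ℝ} (hu : ∀ i, 0 ≤ u i) (huv : ∀ i, u i ≤ v i) (hv : ∀ i, v i ≤ 1) :
    |(((Finset.range N).filter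
        (fun n => ∀ i, radInv (b i) (M n) ∈ Set.Ico (u i) (v i))).card : ℝ)
      - N * ∏ i, (v i - u i)| ≤ T + 2 * s := by
  have hbJ : ∀ i, (0 : ℝ) < (b i : ℝ) ^ J := fun i => by have := hb i; positivity
  set U : Fin s → ℕ := fun i => ⌈u i * b i ^ J⌉₊
  set V : Fin s → ℕ := fun i => ⌈v i * b i ^ J⌉₊
  have hU : ∀ i, u i * b i ^ J ≤ U i := fun i => Nat.le_ceil _
  have hU' : ∀ i, (U i : ℝ) < u i * b i ^ J + 1 := fun i =>
    Nat.ceil_lt_add_one (mul_nonneg (hu i) (hbJ i).le)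
  have hV : ∀ i, v i * b i ^ J ≤ V i := fun i => Nat.le_ceil _
  have hV' : ∀ i, (V i : ℝ) < v i * b i ^ J + 1 := fun i =>
    Nat.ceil_lt_add_one (mul_nonneg ((hu i).trans (huv i)) (hbJ i).le)
  have hUV : ∀ i, U i ≤ V i := fun i =>
    Nat.ceil_mono (mul_le_mul_of_nonneg_right (huv i) (hbJ i).le)
  have hVJ : ∀ i, V i ≤ b i ^ J := fun i => Nat.ceil_le.2 (by
    push_cast; exact mul_le_of_le_one_left (hbJ i).le (hv i))
  have hcard : (((Finset.range N).filter
      (fun n => ∀ i, radInv (b i) (M n) ∈ Set.Ico (u i) (v i))).card : ℝ) =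
      ∑ n ∈ Finset.range N, ∏ i,
        if radInv (b i) (M n) ∈ Set.Ico (u i) (v i) then (1 : ℝ) else 0 := by
    simp_rw [Finset.prod_boole, Finset.mem_univ, true_implies]
    rw [Finset.sum_boole]
  have hvol : ∀ A C : Fin s → ℕ, (∀ i, A i ≤ C i) → (∀ i, C i ≤ b i ^ J) →
      (∀ i, |((C i : ℝ) - A i) - (v i - u i) * b i ^ J| ≤ 2) →
      |N * ∏ i, (((C i : ℝ) - A i) / b i ^ J) - N * ∏ i, (v i - u i)| ≤ 2 * s := by
    intro A C hAC hC h
    rw [← mul_sub, abs_mul, abs_of_nonneg (Nat.cast_nonneg N)]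
    have h1 := abs_prod_sub_prod_le_sum Finset.univ
      (x := fun i => ((C i : ℝ) - A i) / b i ^ J) (y := fun i => v i - u i)
      (fun i => by
        have h2 : (A i : ℝ) ≤ C i := by exact_mod_cast hAC i
        have h3 : (C i : ℝ) ≤ b i ^ J := by exact_mod_cast hC i
        refine ⟨div_nonneg (by linarith) (hbJ i).le, ?_⟩
        rw [div_le_one (hbJ i)]
        linarith [(Nat.cast_nonneg (A i) : (0 : ℝ) ≤ A i)])
      (fun i => ⟨by linarith [huv i], by linarith [hu i, hv i]⟩)
    refine (mul_le_mul_of_nonneg_left h1 (Nat.cast_nonneg N)).trans ?_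
    rw [Finset.mul_sum]
    refine (Finset.sum_le_card_nsmul _ _ 2 fun i _ => ?_).trans ?_
    · have h2 : ((C i : ℝ) - A i) / b i ^ J - (v i - u i) =
          (((C i : ℝ) - A i) - (v i - u i) * b i ^ J) / b i ^ J := by
        have := (hbJ i).ne'
        field_simp
      have h3 : (N : ℝ) ≤ b i ^ J := by exact_mod_cast hN i
      rw [h2, abs_div, abs_of_pos (hbJ i), mul_div_assoc', div_le_iff₀ (hbJ i)]
      nlinarith [h i, abs_nonneg (((C i : ℝ) - A i) - (v i - u i) * b i ^ J)]
    · simp [mul_comm]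
  have hlow : ∀ i m, digitRev (b i) J m ∈ Set.Ico (U i) (max (U i) (V i - 1)) →
      radInv (b i) m ∈ Set.Ico (u i) (v i) := by
    intro i m hm
    rw [Set.mem_Ico] at hm ⊢
    have h1 : digitRev (b i) J m + 1 < V i := by
      rcases lt_max_iff.1 hm.2 with h | h <;> omega
    have h2 : ((digitRev (b i) J m + 1 : ℕ) : ℝ) < v i * b i ^ J := Nat.lt_ceil.1 h1
    have h3 : (U i : ℝ) ≤ digitRev (b i) J m := by exact_mod_cast hm.1
    push_cast at h2
    constructor
    · refine le_trans ?_ (digitRev_div_le_radInv (hb i) J m)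
      rw [le_div_iff₀ (hbJ i)]
      exact (hU i).trans h3
    · refine (radInv_le_digitRev_add_one_div (hb i) J m).trans_lt ?_
      rwa [div_lt_iff₀ (hbJ i)]
  have hupp : ∀ i m, radInv (b i) m ∈ Set.Ico (u i) (v i) →
      digitRev (b i) J m ∈ Set.Ico (U i - 1) (V i) := by
    intro i m hm
    rw [Set.mem_Ico] at hm ⊢
    constructor
    · have h1 := hm.1.trans (radInv_le_digitRev_add_one_div (hb i) J m)
      rw [le_div_iff₀ (hbJ i)] at h1
      have h2 : U i ≤ digitRev (b i) J m + 1 := Nat.ceil_le.2 (by push_cast; exact h1)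
      omega
    · have h1 := (digitRev_div_le_radInv (hb i) J m).trans_lt hm.2
      rw [div_lt_iff₀ (hbJ i)] at h1
      exact Nat.lt_ceil.2 h1
  rw [hcard]
  have hmono : ∀ (P Q : Fin s → ℕ → Prop) [∀ i m, Decidable (P i m)] [∀ i m, Decidable (Q i m)],
      (∀ i m, P i m → Q i m) →
      ∑ n ∈ Finset.range N, ∏ i, (if P i (M n) then (1 : ℝ) else 0) ≤
        ∑ n ∈ Finset.range N, ∏ i, (if Q i (M n) then (1 : ℝ) else 0) := by
    intro P Q _ _ hPQ
    refine Finset.sum_le_sum fun n _ => Finset.prod_le_prod (fun i _ => by positivity) fun i _ => ?_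
    by_cases hP : P i (M n)
    · rw [if_pos hP, if_pos (hPQ i _ hP)]
    · rw [if_neg hP]; positivity
  have hl := hmono _ _ hlow
  have hr := hmono _ _ hupp
  have hC1 : ∀ i, max (U i) (V i - 1) ≤ b i ^ J := fun i =>
    max_le ((hUV i).trans (hVJ i)) ((Nat.sub_le _ _).trans (hVJ i))
  have hA2 : ∀ i, U i - 1 ≤ V i := fun i => (Nat.sub_le _ _).trans (hUV i)
  have hl1 := hT U (fun i => max (U i) (V i - 1)) (fun i => le_max_left _ _) hC1
  have hl2 := hvol U (fun i => max (U i) (V i - 1)) (fun i => le_max_left _ _) hC1 fun i => by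
    have h1 : (V i : ℝ) - 1 ≤ (max (U i) (V i - 1) : ℕ) := by
      have : V i ≤ max (U i) (V i - 1) + 1 := by omega
      have : (V i : ℝ) ≤ (max (U i) (V i - 1) : ℕ) + 1 := by exact_mod_cast this
      linarith
    have h2 : ((max (U i) (V i - 1) : ℕ) : ℝ) ≤ V i := by
      exact_mod_cast max_le (hUV i) (Nat.sub_le _ _)
    have := hU i; have := hU' i; have := hV i; have := hV' i
    rw [abs_le]; constructor <;> nlinarith
  have hr1 := hT (fun i => U i - 1) V hA2 hVJ
  have hr2 := hvol (fun i => U i - 1) V hA2 hVJ fun i => by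
    have h1 : (U i : ℝ) - 1 ≤ (U i - 1 : ℕ) := by
      have : U i ≤ (U i - 1) + 1 := by omega
      have : (U i : ℝ) ≤ (U i - 1 : ℕ) + 1 := by exact_mod_cast this
      linarith
    have h2 : ((U i - 1 : ℕ) : ℝ) ≤ U i := by exact_mod_cast Nat.sub_le _ _
    have := hU i; have := hU' i; have := hV i; have := hV' i
    rw [abs_le]; constructor <;> nlinarith
  rw [abs_le] at hl1 hl2 hr1 hr2 ⊢
  constructor <;> linarith [hl1.1, hl1.2, hl2.1, hl2.2, hr1.1, hr1.2, hr2.1, hr2.2]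

/-- The set of `β` for which `q β / B` is within `1 / (2 ^ k + 1)` of a positive integer. -/
def approxSet (B k q : ℕ) : Set ℝ :=
  {β | ∃ p : ℤ, 1 ≤ p ∧ |q * (β / B) - p| ≤ 1 / (2 ^ k + 1)}

lemma measurableSet_approxSet (B k q : ℕ) : MeasurableSet (approxSet B k q) := by
  have : approxSet B k q =
      ⋃ p : ℤ, {β : ℝ | 1 ≤ p ∧ |q * (β / B) - p| ≤ 1 / (2 ^ k + 1)} := by
    ext; simp [approxSet]
  rw [this]
  refine MeasurableSet.iUnion fun p => (MeasurableSet.const _).inter ?_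
  exact measurableSet_le (f := fun β : ℝ => |q * (β / B) - p|) (by fun_prop) measurable_const

lemma volume_approxSet_inter_le {B k q : ℕ} (hB : 0 < B) (hq : 0 < q) {R : ℝ} (hR : 0 ≤ R) :
    volume (approxSet B k q ∩ Set.Ioc 0 R) ≤ ENNReal.ofReal (4 * R / 2 ^ k) := by
  have hB' : (0 : ℝ) < B := by exact_mod_cast hB
  have hq' : (0 : ℝ) < q := by exact_mod_cast hq
  set t : ℝ := 1 / (2 ^ k + 1) with ht
  have ht0 : 0 < t := by positivity
  have ht1 : t ≤ 1 / 2 := by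
    have : (1 : ℝ) ≤ 2 ^ k := one_le_pow₀ one_le_two
    exact one_div_le_one_div_of_le two_pos (by linarith)
  have hsub : approxSet B k q ∩ Set.Ioc 0 R ⊆
      ⋃ p ∈ Finset.Icc (1 : ℤ) ⌊2 * q * R / B⌋, Set.Icc ((p - t) * B / q) ((p + t) * B / q) := by
    rintro β ⟨⟨p, hp, h⟩, hβ0, hβ⟩
    rw [abs_le] at h
    have h1 : (q : ℝ) * (β / B) ≤ q * (R / B) := by gcongr
    have hp' : (1 : ℝ) ≤ p := by exact_mod_cast hp
    simp only [Set.mem_iUnion, exists_prop]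
    refine ⟨p, Finset.mem_Icc.2 ⟨hp, ?_⟩, ?_, ?_⟩
    · rw [Int.le_floor, show 2 * q * R / B = 2 * (q * (R / B)) by ring]
      linarith
    · rw [div_le_iff₀ hq']
      have h2 := mul_le_mul_of_nonneg_right (show (p : ℝ) - t ≤ q * (β / B) by linarith) hB'.le
      rwa [show q * (β / B) * B = β * q by field_simp] at h2
    · rw [le_div_iff₀ hq']
      have h2 := mul_le_mul_of_nonneg_right (show q * (β / B) ≤ (p : ℝ) + t by linarith) hB'.le
      rwa [show q * (β / B) * B = β * q by field_simp] at h2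
  refine (measure_mono hsub).trans ((measure_biUnion_finset_le _ _).trans ?_)
  have hvol : ∀ p : ℤ, volume (Set.Icc ((p - t) * B / q) ((p + t) * B / q)) =
      ENNReal.ofReal (2 * t * B / q) := fun p => by
    rw [Real.volume_Icc]; congr 1; ring
  simp_rw [hvol]
  rw [Finset.sum_const, Int.card_Icc, nsmul_eq_mul, ← ENNReal.ofReal_natCast,
    ← ENNReal.ofReal_mul (Nat.cast_nonneg _)]
  refine ENNReal.ofReal_le_ofReal ?_
  have h0 : 0 ≤ ⌊2 * q * R / B⌋ := Int.floor_nonneg.2 (by positivity)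
  have h1 : (((⌊2 * q * R / B⌋ + 1 - 1).toNat : ℕ) : ℝ) ≤ 2 * q * R / B := by
    rw [add_sub_cancel_right, ← Int.cast_natCast, Int.toNat_of_nonneg h0]
    exact Int.floor_le _
  have h2 : t ≤ 1 / 2 ^ k := one_div_le_one_div_of_le (by positivity) (by linarith)
  calc _ ≤ 2 * q * R / B * (2 * t * B / q) := by gcongr
    _ = 4 * R * t := by field_simp; ring
    _ ≤ 4 * R * (1 / 2 ^ k) := by gcongr
    _ = _ := by ring

/-- Sum of the `ρ`-th powers of the ratios `2 ^ k / q` over the good denominators `q ≤ 2 ^ k`. -/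
noncomputable def approxWeight (ρ : ℝ) (B k : ℕ) (β : ℝ) : ENNReal :=
  ∑ q ∈ Finset.Icc 1 (2 ^ k),
    (approxSet B k q).indicator (fun _ => ENNReal.ofReal ((2 ^ k / q) ^ ρ)) β

lemma measurable_approxWeight (ρ : ℝ) (B k : ℕ) : Measurable (approxWeight ρ B k) :=
  Finset.measurable_fun_sum _ fun q _ => measurable_const.indicator (measurableSet_approxSet B k q)

lemma sum_Icc_rpow_neg_le {ρ : ℝ} (hρ0 : 0 ≤ ρ) (hρ : ρ < 1) (Q : ℕ) :
    ∑ q ∈ Finset.Icc 1 Q, (q : ℝ) ^ (-ρ) ≤ (Q : ℝ) ^ (1 - ρ) / (1 - ρ) := by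
  have h0 : 0 < 1 - ρ := by linarith
  induction Q with
  | zero => simp [Real.zero_rpow h0.ne']
  | succ Q ih =>
    rw [Finset.sum_Icc_succ_top (by omega)]
    have hQ : (0 : ℝ) < (Q + 1 : ℕ) := by positivity
    have hb := rpow_one_add_le_one_add_mul_self (s := -(1 / ((Q + 1 : ℕ) : ℝ)))
      (by rw [neg_le_neg_iff, div_le_one hQ]; push_cast; linarith [(Nat.cast_nonneg Q : (0:ℝ) ≤ Q)])
      h0.le (by linarith)
    have h1 : (Q : ℝ) = (Q + 1 : ℕ) * (1 + -(1 / ((Q + 1 : ℕ) : ℝ))) := by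
      field_simp; push_cast; ring
    have h2 : (0 : ℝ) ≤ 1 + -(1 / ((Q + 1 : ℕ) : ℝ)) := by
      have : 1 / ((Q + 1 : ℕ) : ℝ) ≤ 1 := by
        rw [div_le_one hQ]; push_cast; linarith [(Nat.cast_nonneg Q : (0:ℝ) ≤ Q)]
      linarith
    have h3 : (Q : ℝ) ^ (1 - ρ) ≤
        ((Q + 1 : ℕ) : ℝ) ^ (1 - ρ) - (1 - ρ) * ((Q + 1 : ℕ) : ℝ) ^ (-ρ) := by
      have h4 : ((Q + 1 : ℕ) : ℝ) ^ (1 - ρ) = (Q + 1 : ℕ) * ((Q + 1 : ℕ) : ℝ) ^ (-ρ) := by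
        rw [sub_eq_add_neg, Real.rpow_add hQ, Real.rpow_one]
      calc (Q : ℝ) ^ (1 - ρ) = ((Q + 1 : ℕ) : ℝ) ^ (1 - ρ) *
            (1 + -(1 / ((Q + 1 : ℕ) : ℝ))) ^ (1 - ρ) := by
            conv_lhs => rw [h1]
            rw [Real.mul_rpow hQ.le h2]
        _ ≤ ((Q + 1 : ℕ) : ℝ) ^ (1 - ρ) * (1 + (1 - ρ) * -(1 / ((Q + 1 : ℕ) : ℝ))) := by gcongr
        _ = _ := by rw [h4]; field_simp; ring
    have h5 := div_le_div_of_nonneg_right h3 h0.le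
    rw [sub_div, mul_div_cancel_left₀ _ h0.ne'] at h5
    linarith

lemma lintegral_approxWeight_le {ρ : ℝ} (hρ0 : 0 ≤ ρ) (hρ : ρ < 1) {B : ℕ} (hB : 0 < B) (k : ℕ)
    {R : ℝ} (hR : 0 ≤ R) :
    ∫⁻ β in Set.Ioc 0 R, approxWeight ρ B k β ≤ ENNReal.ofReal (4 * R / (1 - ρ)) := by
  have h0 : 0 < 1 - ρ := by linarith
  unfold approxWeight
  rw [lintegral_finsetSum _ fun q _ => measurable_const.indicator (measurableSet_approxSet B k q)]
  calc _ ≤ ∑ q ∈ (Finset.Icc 1 (2 ^ k) : Finset ℕ), ENNReal.ofReal ((2 ^ k / (q : ℝ)) ^ ρ * (4 * R / 2 ^ k)) := by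
        refine Finset.sum_le_sum fun q hq => ?_
        rw [lintegral_indicator_const (measurableSet_approxSet B k q),
          Measure.restrict_apply (measurableSet_approxSet B k q), ENNReal.ofReal_mul (by positivity)]
        gcongr
        exact volume_approxSet_inter_le hB (Finset.mem_Icc.1 hq).1 hR
    _ = ENNReal.ofReal (∑ q ∈ (Finset.Icc 1 (2 ^ k) : Finset ℕ), (2 ^ k / (q : ℝ)) ^ ρ * (4 * R / 2 ^ k)) := by
        rw [ENNReal.ofReal_sum_of_nonneg fun q _ => by positivity]
    _ ≤ _ := by
        refine ENNReal.ofReal_le_ofReal ?_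
        have h1 : ∀ q : ℕ, (2 ^ k / (q : ℝ)) ^ ρ * (4 * R / 2 ^ k) =
            4 * R * ((2 : ℝ) ^ k) ^ (ρ - 1) * (q : ℝ) ^ (-ρ) := fun q => by
          rw [Real.div_rpow (by positivity) (by positivity), Real.rpow_sub (by positivity),
            Real.rpow_one, Real.rpow_neg (by positivity)]
          ring
        simp_rw [h1]
        rw [← Finset.mul_sum]
        have h2 := sum_Icc_rpow_neg_le hρ0 hρ (2 ^ k)
        push_cast at h2
        calc _ ≤ 4 * R * ((2 : ℝ) ^ k) ^ (ρ - 1) * (((2 : ℝ) ^ k) ^ (1 - ρ) / (1 - ρ)) := by gcongr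
          _ = 4 * R * (((2 : ℝ) ^ k) ^ (ρ - 1) * ((2 : ℝ) ^ k) ^ (1 - ρ)) / (1 - ρ) := by ring
          _ = _ := by rw [← Real.rpow_add (by positivity)]; simp

lemma ae_exists_sum_approxWeight_le {s : ℕ} {b : Fin s → ℕ} (hb : ∀ i, 2 ≤ b i) {ρ τ : ℝ}
    (hρ0 : 0 ≤ ρ) (hρ : ρ < 1) (hτ : s + 1 < τ) :
    ∀ᵐ β : ℝ, 0 < β → ∃ S : ℝ, 0 ≤ S ∧ ∀ l : ℕ,
      ∑ j ∈ Fintype.piFinset fun _ : Fin s => Finset.range (2 ^ l + 1), ∑ k ∈ Finset.range (2 ^ l),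
        approxWeight ρ (∏ i, b i ^ j i) k β ≤ ENNReal.ofReal (S * (2 ^ l) ^ τ) := by
  set A : ℕ → ℝ → ENNReal := fun l β =>
    ∑ j ∈ Fintype.piFinset fun _ : Fin s => Finset.range (2 ^ l + 1), ∑ k ∈ Finset.range (2 ^ l),
      approxWeight ρ (∏ i, b i ^ j i) k β with hA
  have hAm : ∀ l, Measurable (A l) := fun l =>
    Finset.measurable_fun_sum _ fun j _ => Finset.measurable_fun_sum _ fun k _ =>
      measurable_approxWeight _ _ _
  have hAint : ∀ (R : ℕ) (l : ℕ), ∫⁻ β in Set.Ioc 0 (R : ℝ), A l β ≤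
      ENNReal.ofReal (2 ^ (s + 1) * (4 * R / (1 - ρ)) * (2 ^ l) ^ (s + 1)) := by
    intro R l
    have h0 : 0 < 1 - ρ := by linarith
    rw [hA, lintegral_finsetSum _ fun j _ => Finset.measurable_fun_sum _ fun k _ =>
      measurable_approxWeight _ _ _]
    simp_rw [lintegral_finsetSum _ fun k _ => measurable_approxWeight _ _ k]
    calc _ ≤ ∑ j ∈ Fintype.piFinset fun _ : Fin s => Finset.range (2 ^ l + 1),
          ∑ k ∈ Finset.range (2 ^ l), ENNReal.ofReal (4 * R / (1 - ρ)) := by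
          gcongr with j _ k _
          exact lintegral_approxWeight_le hρ0 hρ
            (Finset.prod_pos fun i _ => pow_pos (by have := hb i; omega) _) k (Nat.cast_nonneg R)
      _ = ENNReal.ofReal (((2 ^ l + 1) ^ s * 2 ^ l : ℕ) * (4 * R / (1 - ρ))) := by
          rw [Finset.sum_const, Finset.sum_const, smul_smul, nsmul_eq_mul,
            ENNReal.ofReal_mul (Nat.cast_nonneg _), ENNReal.ofReal_natCast,
            Fintype.card_piFinset]
          simp
      _ ≤ _ := by
          refine ENNReal.ofReal_le_ofReal ?_
          have h1 : (2 ^ l + 1) ^ s * 2 ^ l ≤ 2 ^ (s + 1) * (2 ^ l) ^ (s + 1) := by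
            rw [← mul_pow, pow_succ]
            have := Nat.one_le_two_pow (n := l)
            gcongr <;> omega
          have h2 : (((2 ^ l + 1) ^ s * 2 ^ l : ℕ) : ℝ) ≤ 2 ^ (s + 1) * (2 ^ l) ^ (s + 1) := by
            exact_mod_cast h1
          calc _ ≤ (2 ^ (s + 1) * (2 ^ l) ^ (s + 1)) * (4 * R / (1 - ρ)) := by gcongr
            _ = _ := by ring
  have hfin : ∀ R : ℕ, ∀ᵐ β : ℝ, β ∈ Set.Ioc 0 (R : ℝ) →
      ∑' l, A l β * ENNReal.ofReal (((2 : ℝ) ^ l) ^ (-τ)) < ⊤ := by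
    intro R
    rw [← ae_restrict_iff' measurableSet_Ioc]
    refine ae_lt_top (Measurable.tsum fun l => (hAm l).mul_const _) ?_
    rw [lintegral_tsum fun l => ((hAm l).mul_const _).aemeasurable]
    have hx : (2 : ℝ) ^ (s + 1 - τ) < 1 := Real.rpow_lt_one_of_one_lt_of_neg one_lt_two (by linarith)
    have hle : ∀ l, ∫⁻ β in Set.Ioc 0 (R : ℝ), A l β * ENNReal.ofReal (((2 : ℝ) ^ l) ^ (-τ)) ≤
        ENNReal.ofReal (2 ^ (s + 1) * (4 * R / (1 - ρ))) *
          ENNReal.ofReal ((2 : ℝ) ^ (s + 1 - τ)) ^ l := by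
      intro l
      have h0 : 0 < 1 - ρ := by linarith
      rw [lintegral_mul_const _ (hAm l), ← ENNReal.ofReal_pow (by positivity),
        ← ENNReal.ofReal_mul (by positivity)]
      refine (mul_le_mul_left (hAint R l) _).trans ?_
      rw [← ENNReal.ofReal_mul (by positivity)]
      refine ENNReal.ofReal_le_ofReal (le_of_eq ?_)
      rw [mul_assoc]
      congr 1
      rw [← Real.rpow_natCast (2 ^ l) (s + 1), ← Real.rpow_add (by positivity),
        ← Real.rpow_natCast 2 l, ← Real.rpow_mul two_pos.le, ← Real.rpow_natCast _ l,
        ← Real.rpow_mul two_pos.le]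
      push_cast
      ring_nf
    refine ne_top_of_le_ne_top ?_ (ENNReal.tsum_le_tsum hle)
    rw [ENNReal.tsum_mul_left, ENNReal.tsum_geometric]
    refine ENNReal.mul_ne_top ENNReal.ofReal_ne_top (ENNReal.inv_ne_top.2 ?_)
    rw [ne_eq, tsub_eq_zero_iff_le, not_le]
    exact ENNReal.ofReal_lt_one.2 hx
  rw [← ae_all_iff] at hfin
  filter_upwards [hfin] with β hβ hβ0
  obtain ⟨R, hR⟩ := exists_nat_ge β
  have hlt := hβ R ⟨hβ0, hR⟩
  set X := ∑' l, A l β * ENNReal.ofReal (((2 : ℝ) ^ l) ^ (-τ))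
  refine ⟨X.toReal, ENNReal.toReal_nonneg, fun l => ?_⟩
  have h1 : A l β * ENNReal.ofReal (((2 : ℝ) ^ l) ^ (-τ)) ≤ X := ENNReal.le_tsum l
  rw [ENNReal.ofReal_mul ENNReal.toReal_nonneg, ENNReal.ofReal_toReal hlt.ne]
  calc A l β = A l β * ENNReal.ofReal (((2 : ℝ) ^ l) ^ (-τ)) * ENNReal.ofReal ((2 ^ l) ^ τ) := by
        rw [mul_assoc, ← ENNReal.ofReal_mul (by positivity), ← Real.rpow_add (by positivity)]
        simp
    _ ≤ _ := by gcongr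

lemma rpow_sum_le_sum_rpow_of_le_one {ι : Type*} (t : Finset ι) {x : ι → ℝ} (hx : ∀ i, 0 ≤ x i)
    {ρ : ℝ} (hρ0 : 0 < ρ) (hρ : ρ ≤ 1) : (∑ i ∈ t, x i) ^ ρ ≤ ∑ i ∈ t, x i ^ ρ := by
  induction t using Finset.induction_on with
  | empty => simp [Real.zero_rpow hρ0.ne']
  | insert a t ha ih =>
    rw [Finset.sum_insert ha, Finset.sum_insert ha]
    exact (Real.rpow_add_le_add_rpow (hx a) (Finset.sum_nonneg fun i _ => hx i) hρ0.le hρ).trans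
      (by gcongr)

lemma exists_lt_two_pow_two_pow {N : ℕ} (hN : 2 ≤ N) :
    ∃ l : ℕ, N < 2 ^ 2 ^ l ∧ (2 : ℝ) ^ l ≤ 4 * Real.log N := by
  have hex : ∃ l : ℕ, N < 2 ^ 2 ^ l :=
    ⟨N, Nat.lt_two_pow_self.trans_le (Nat.pow_le_pow_right two_pos Nat.lt_two_pow_self.le)⟩
  refine ⟨Nat.find hex, Nat.find_spec hex, ?_⟩
  have h1 : Nat.find hex ≠ 0 := by
    intro h
    have := Nat.find_spec hex
    rw [h] at this
    omega
  obtain ⟨l, hl⟩ := Nat.exists_eq_succ_of_ne_zero h1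
  have h2 := Nat.find_min hex (m := l) (by omega)
  rw [not_lt] at h2
  have h3 : ((2 : ℝ) ^ 2 ^ l) ≤ N := by exact_mod_cast h2
  have h4 := Real.log_le_log (by positivity) h3
  rw [Real.log_pow] at h4
  push_cast at h4
  have h5 := Real.log_two_gt_d9
  rw [hl, pow_succ]
  have h6 : (0 : ℝ) < 2 ^ l := by positivity
  nlinarith

lemma exists_abs_card_radInv_floor_sub_le {s : ℕ} {b : Fin s → ℕ} (hb : ∀ i, 2 ≤ b i)
    (hcop : ∀ i j, i ≠ j → Nat.Coprime (b i) (b j)) {β : ℝ} (hβ : 0 < β) {ρ τ S : ℝ}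
    (hρ0 : 0 < ρ) (hρ : ρ ≤ 1) (hsτ : s ≤ τ / ρ) (hS0 : 0 ≤ S)
    (hS : ∀ l : ℕ, ∑ j ∈ Fintype.piFinset fun _ : Fin s => Finset.range (2 ^ l + 1),
      ∑ k ∈ Finset.range (2 ^ l), approxWeight ρ (∏ i, b i ^ j i) k β
        ≤ ENNReal.ofReal (S * (2 ^ l) ^ τ)) :
    ∃ C > (0 : ℝ), ∀ l N : ℕ, N < 2 ^ 2 ^ l →
      ∀ u v : Fin s → ℝ, (∀ i, 0 ≤ u i) → (∀ i, u i ≤ v i) → (∀ i, v i ≤ 1) →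
        |(((Finset.range N).filter
            (fun n : ℕ => ∀ i, radInv (b i) (⌊(n : ℝ) * β⌋.toNat) ∈ Set.Ico (u i) (v i))).card : ℝ)
          - N * ∏ i, (v i - u i)| ≤ C * (2 ^ l) ^ (τ / ρ) := by
  have hbpos : ∀ j : Fin s → ℕ, 0 < ∏ i, b i ^ j i := fun j =>
    Finset.prod_pos fun i _ => pow_pos (by have := hb i; omega) _
  choose a ha0 ha hbound using fun j : Fin s → ℕ =>
    abs_sum_mod_eq_sub_le hβ (∏ i, b i ^ j i) (hbpos j)
  set D : ℝ := 3 * (1 / β + 1) with hD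
  have hD0 : 0 < D := by positivity
  set W : ℝ := ((∏ i, (b i + b i) : ℕ) : ℝ) with hW
  have hW0 : 0 ≤ W := Nat.cast_nonneg _
  refine ⟨W * (2 ^ s * D + 6 * S ^ (1 / ρ)) + 2 * s + 1, by positivity, ?_⟩
  intro l N hN u v hu huv hv
  set P := Fintype.piFinset fun _ : Fin s => Finset.range (2 ^ l + 1) with hP
  have hl1 : (1 : ℝ) ≤ 2 ^ l := one_le_pow₀ one_le_two
  have hweight : ∀ j k, ENNReal.ofReal (a j k ^ ρ) ≤ approxWeight ρ (∏ i, b i ^ j i) k β := by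
    intro j k
    rcases ha j k with h | ⟨q, hq, hp, h⟩
    · simp [h, Real.zero_rpow hρ0.ne']
    · rw [h, approxWeight]
      refine le_trans ?_ (Finset.single_le_sum (fun q _ => zero_le) hq)
      rw [Set.indicator_of_mem]
      exact hp
  have hsum : ∑ j ∈ P, ∑ k ∈ Finset.range (2 ^ l), a j k ≤ S ^ (1 / ρ) * (2 ^ l) ^ (τ / ρ) := by
    have h1 : ∑ j ∈ P, ∑ k ∈ Finset.range (2 ^ l), a j k ^ ρ ≤ S * (2 ^ l) ^ τ := by
      rw [← ENNReal.ofReal_le_ofReal_iff (by positivity), ENNReal.ofReal_sum_of_nonneg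
        fun j _ => Finset.sum_nonneg fun k _ => Real.rpow_nonneg (ha0 j k) _]
      refine le_trans (Finset.sum_le_sum fun j _ => ?_) (hS l)
      rw [ENNReal.ofReal_sum_of_nonneg fun k _ => Real.rpow_nonneg (ha0 j k) _]
      exact Finset.sum_le_sum fun k _ => hweight j k
    have h2 := rpow_sum_le_sum_rpow_of_le_one (P ×ˢ Finset.range (2 ^ l))
      (x := fun x => a x.1 x.2) (fun x => ha0 _ _) hρ0 hρ
    rw [Finset.sum_product, Finset.sum_product] at h2
    have h3 : 0 ≤ ∑ j ∈ P, ∑ k ∈ Finset.range (2 ^ l), a j k :=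
      Finset.sum_nonneg fun j _ => Finset.sum_nonneg fun k _ => ha0 j k
    have h4 := Real.rpow_le_rpow (Real.rpow_nonneg h3 _) (h2.trans h1)
      (show 0 ≤ 1 / ρ by positivity)
    rw [← Real.rpow_mul h3, mul_one_div_cancel hρ0.ne', Real.rpow_one,
      Real.mul_rpow hS0 (by positivity), ← Real.rpow_mul (by positivity), mul_one_div] at h4
    exact h4
  have hcard : (P.card : ℝ) ≤ 2 ^ s * (2 ^ l) ^ (τ / ρ) := by
    rw [hP, Fintype.card_piFinset]
    simp only [Finset.card_range, Finset.prod_const, Finset.card_univ, Fintype.card_fin]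
    push_cast
    calc ((2 : ℝ) ^ l + 1) ^ s ≤ (2 * 2 ^ l) ^ s := by gcongr; linarith
      _ = 2 ^ s * ((2 : ℝ) ^ l) ^ (s : ℝ) := by rw [mul_pow, Real.rpow_natCast]
      _ ≤ _ := by gcongr
  have hT := abs_card_radInv_mem_sub_le hb (fun n => ⌊(n : ℝ) * β⌋.toNat) (J := 2 ^ l) (N := N)
    (fun i => hN.le.trans (Nat.pow_le_pow_left (hb i) _))
    (T := W * ∑ j ∈ P, (D + 6 * ∑ k ∈ Finset.range (2 ^ l), a j k))
    (fun A C hAC hC => abs_sum_prod_sub_le hb hcop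
      (fun i => isAdicComb_digitRev_mem_Ico (hb i) (2 ^ l) (A i) (C i) (hAC i) (hC i))
      (fun n => ⌊(n : ℝ) * β⌋.toNat) N _ fun j r hr => hbound j (2 ^ l) N hN r hr) hu huv hv
  refine hT.trans ?_
  rw [Finset.sum_add_distrib, Finset.sum_const, nsmul_eq_mul, ← Finset.mul_sum]
  have hone : 1 ≤ ((2 : ℝ) ^ l) ^ (τ / ρ) :=
    Real.one_le_rpow hl1 ((Nat.cast_nonneg s).trans hsτ)
  set Z := ((2 : ℝ) ^ l) ^ (τ / ρ)
  have h1 : W * (P.card * D + 6 * ∑ j ∈ P, ∑ k ∈ Finset.range (2 ^ l), a j k) ≤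
      W * (2 ^ s * Z * D + 6 * (S ^ (1 / ρ) * Z)) := by gcongr
  have h2 : (2 * s + 1 : ℝ) * 1 ≤ (2 * s + 1) * Z := by gcongr
  nlinarith

lemma card_filter_cast_range (N : ℕ) (p : ℝ → Prop) [DecidablePred p] :
    ((do let a ← Finset.range N; pure (a : ℝ) : Finset ℝ).filter p).card =
      ((Finset.range N).filter fun n : ℕ => p n).card := by
  have : ((do let a ← Finset.range N; pure (a : ℝ) : Finset ℝ).filter p) =
      ((Finset.range N).filter fun n : ℕ => p n).image Nat.cast := by
    ext x
    simp only [Finset.bind_def, Finset.pure_def, Finset.mem_filter, Finset.mem_sup,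
      Finset.mem_singleton, Finset.mem_image]
    grind
  rw [this, Finset.card_image_of_injective _ Nat.cast_injective]

/-- For almost every `β > 0`: for every `ε > 0` there is `C > 0` such that for all `N ≥ 2`
and every half-open box `J = ∏ [u i, v i) ⊆ [0,1)^s`, the first `N` points of the sequence
`x_n = (φ_{b_1}(⌊nβ⌋), …, φ_{b_s}(⌊nβ⌋))` satisfy `|A_N(J) - N·λ_s(J)| ≤ C (log N)^{s+1+ε}`;
i.e. `N · D_N ≤ C (log N)^{s+1+ε}`. -/
theorem stmt0 (s : ℕ) (hs : 1 ≤ s) (b : Fin s → ℕ) (hb : ∀ i, 2 ≤ b i)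
    (hcop : ∀ i j, i ≠ j → Nat.Coprime (b i) (b j)) :
    ∀ᵐ β : ℝ, 0 < β →
      ∀ ε > (0 : ℝ), ∃ C > (0 : ℝ), ∀ N : ℕ, 2 ≤ N →
        ∀ u v : Fin s → ℝ, (∀ i, 0 ≤ u i) → (∀ i, u i ≤ v i) → (∀ i, v i ≤ 1) →
          |(((Finset.range N).filter
              (fun n => ∀ i, radInv (b i) (⌊(n : ℝ) * β⌋.toNat) ∈ Set.Ico (u i) (v i))).card : ℝ)
            - N * ∏ i, (v i - u i)| ≤ C * Real.log N ^ ((s : ℝ) + 1 + ε) := by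
  have hδ : ∀ m : ℕ, (0 : ℝ) < 1 / (m + 1) := fun m => by positivity
  have hae := ae_all_iff.2 fun m : ℕ => ae_exists_sum_approxWeight_le hb
    (ρ := ((s : ℝ) + 1 + 1 / (m + 1) / 2) / ((s : ℝ) + 1 + 1 / (m + 1)))
    (τ := (s : ℝ) + 1 + 1 / (m + 1) / 2) (by positivity)
    (by have := hδ m; rw [div_lt_one (by positivity)]; linarith) (by have := hδ m; linarith)
  filter_upwards [hae] with β hβ hβ0 ε hε
  obtain ⟨m, hm⟩ := exists_nat_one_div_lt hε
  obtain ⟨S, hS0, hS⟩ := hβ m hβ0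
  have hm0 := hδ m
  set δ : ℝ := 1 / (m + 1)
  have hdiv : ((s : ℝ) + 1 + δ / 2) / (((s : ℝ) + 1 + δ / 2) / ((s : ℝ) + 1 + δ)) = s + 1 + δ := by
    field_simp
  obtain ⟨C, hC0, hC⟩ := exists_abs_card_radInv_floor_sub_le hb hcop hβ0 (by positivity)
    (by rw [div_le_one (by positivity)]; linarith) (by rw [hdiv]; linarith) hS0 hS
  rw [hdiv] at hC
  refine ⟨C * 4 ^ ((s : ℝ) + 1 + ε), by positivity, fun N hN u v hu huv hv => ?_⟩
  obtain ⟨l, hl, hlog⟩ := exists_lt_two_pow_two_pow hN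
  rw [card_filter_cast_range]
  refine (hC l N hl u v hu huv hv).trans ?_
  have hlogN : 0 ≤ Real.log N := Real.log_natCast_nonneg N
  rw [mul_assoc, ← Real.mul_rpow (by norm_num) hlogN]
  gcongr
  calc ((2 : ℝ) ^ l) ^ ((s : ℝ) + 1 + δ) ≤ ((2 : ℝ) ^ l) ^ ((s : ℝ) + 1 + ε) := by
        gcongr
        exact one_le_pow₀ one_le_two
    _ ≤ _ := by gcongr
end

section
/- Let β > 1 be a real number and set α = β/(β+1) ∈ (1/2, 1). Then for every integer m ≥ 0, #{n ∈ ℕ, n ≥ 1 : ⌊nα⌋ = m} = #{n ∈ ℕ, n ≥ 1 : ⌊nβ⌋ = m} + 1. (In other words, counted with multiplicity, the sequence (⌊nα⌋)_{n≥1} consists of the values of the sequence (⌊nβ⌋)_{n≥1} together with one copy of every nonnegative integer.) -/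
theorem setOf_floor_mul_eq_Ico {γ : ℝ} (hγ : 0 < γ) (m : ℕ) :
    {n : ℕ | 1 ≤ n ∧ ⌊(n : ℝ) * γ⌋ = (m : ℤ)}
      = Finset.Ico (max 1 ⌈(m : ℝ) / γ⌉₊) ⌈((m + 1 : ℕ) : ℝ) / γ⌉₊ := by
  ext n
  simp [Int.floor_eq_iff, Nat.lt_ceil, div_le_iff₀ hγ, lt_div_iff₀ hγ, and_assoc]

theorem ceil_div_div_add_one {β : ℝ} (hβ : 0 < β) (k : ℕ) :
    ⌈(k : ℝ) / (β / (β + 1))⌉₊ = k + ⌈(k : ℝ) / β⌉₊ := by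
  have h : (k : ℝ) / (β / (β + 1)) = k / β + k := by field_simp; ring
  rw [h, Nat.ceil_add_natCast (by positivity), add_comm]

/-- For `β > 1` and `α = β/(β+1)`: for every `m ≥ 0`,
`#{n ≥ 1 : ⌊nα⌋ = m} = #{n ≥ 1 : ⌊nβ⌋ = m} + 1`. -/
theorem stmt6 (β : ℝ) (hβ : 1 < β) (α : ℝ) (hα : α = β / (β + 1)) (m : ℕ) :
    {n : ℕ | 1 ≤ n ∧ ⌊(n : ℝ) * α⌋ = (m : ℤ)}.ncard
      = {n : ℕ | 1 ≤ n ∧ ⌊(n : ℝ) * β⌋ = (m : ℤ)}.ncard + 1 := by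
  have hβ₀ : 0 < β := by linarith
  subst hα
  rw [setOf_floor_mul_eq_Ico (by positivity), setOf_floor_mul_eq_Ico hβ₀,
    Set.ncard_coe_finset, Set.ncard_coe_finset, Nat.card_Ico, Nat.card_Ico,
    ceil_div_div_add_one hβ₀, ceil_div_div_add_one hβ₀]
  have hle : ⌈(m : ℝ) / β⌉₊ ≤ ⌈((m + 1 : ℕ) : ℝ) / β⌉₊ := by gcongr; simp
  have hpos : 0 < ⌈((m + 1 : ℕ) : ℝ) / β⌉₊ := Nat.ceil_pos.2 (by positivity)
  rcases Nat.eq_zero_or_pos m with rfl | hm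
  · simp only [Nat.cast_zero, zero_div, Nat.ceil_zero]
    omega
  · have hpos' : 0 < ⌈(m : ℝ) / β⌉₊ := Nat.ceil_pos.2 (by positivity)
    omega
end

section
/- Let s ≥ 1 and let b_1, …, b_s ≥ 2 be pairwise coprime integers. Let β > 1 be a real number and set α = β/(β+1) ∈ (1/2,1). Suppose that for every ε > 0 there is a constant C > 0 such that for all N ≥ 2 the sequence y_n = (φ_{b_1}(⌊nα⌋), …, φ_{b_s}(⌊nα⌋)), n ≥ 1, satisfies N · D_N(y_n) ≤ C (log N)^{s+1+ε}. Then for every ε > 0 there is a constant C' > 0 such that for all N ≥ 2 the sequence x_n = (φ_{b_1}(⌊nβ⌋), …, φ_{b_s}(⌊nβ⌋)), n ≥ 1, satisfies N · D_N(x_n) ≤ C' (log N)^{s+1+ε}. -/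
open scoped Classical

/-- `IsResidueComb b n g δ`: the function `g` is a signed sum of at most `n` indicator functions
of residue classes modulo powers of `b`, and `δ` is the corresponding signed sum of densities. -/
inductive IsResidueComb (b : ℕ) : ℕ → (ℕ → ℝ) → ℝ → Prop
  | zero : IsResidueComb b 0 (fun _ => 0) 0
  | single (k r : ℕ) (hr : r < b ^ k) :
      IsResidueComb b 1 (fun m => if m % b ^ k = r then 1 else 0) (1 / (b : ℝ) ^ k)
  | add {n n' : ℕ} {g g' : ℕ → ℝ} {δ δ' : ℝ} (h : IsResidueComb b n g δ)
      (h' : IsResidueComb b n' g' δ') :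
      IsResidueComb b (n + n') (fun m => g m + g' m) (δ + δ')
  | sub {n n' : ℕ} {g g' : ℕ → ℝ} {δ δ' : ℝ} (h : IsResidueComb b n g δ)
      (h' : IsResidueComb b n' g' δ') :
      IsResidueComb b (n + n') (fun m => g m - g' m) (δ - δ')
  | mono {n n' : ℕ} {g : ℕ → ℝ} {δ : ℝ} (hn : n ≤ n') (h : IsResidueComb b n g δ) :
      IsResidueComb b n' g δ

/-- The integer obtained by reversing the first `K` base-`b` digits of `m`. -/
def digitReverse (b : ℕ) : ℕ → ℕ → ℕ
  | 0, _ => 0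
  | K + 1, m => b * digitReverse b K m + m / b ^ K % b

theorem abs_sum_mod_eq_sub_le_s11 (q r M : ℕ) (hr : r < q) :
    |(∑ m ∈ Finset.range M, if m % q = r then (1 : ℝ) else 0) - M / q| ≤ 1 := by
  have hq : 0 < q := by omega
  have key : ((∑ m ∈ Finset.range M, if m % q = r then (1 : ℝ) else 0))
      = ((M / q + if r % q < M % q then 1 else 0 : ℕ) : ℝ) := by
    rw [← Nat.count_modEq_card M hq r, Nat.count_eq_card_filter_range, Finset.sum_boole]
    simp only [Nat.ModEq, Nat.mod_eq_of_lt hr]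
  have hq' : (0 : ℝ) < q := by exact_mod_cast hq
  have hM : (M : ℝ) / q = (M / q : ℕ) + (M % q : ℕ) / (q : ℝ) := by
    have := Nat.div_add_mod M q
    field_simp
    exact_mod_cast this.symm
  have h0 : (0 : ℝ) ≤ (M % q : ℕ) / (q : ℝ) := by positivity
  have h1 : (M % q : ℕ) / (q : ℝ) ≤ 1 := by
    rw [div_le_one hq']
    exact_mod_cast (Nat.mod_lt M hq).le
  rw [key, hM, abs_le]
  split_ifs <;> push_cast <;> constructor <;> linarith

theorem exists_mod_mul_eq_iff {p q r t : ℕ} (hpq : p.Coprime q) (hr : r < p) (ht : t < q) :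
    ∃ w < p * q, ∀ m : ℕ, m % (p * q) = w ↔ m % p = r ∧ m % q = t := by
  obtain ⟨w, hw₁, hw₂⟩ := Nat.chineseRemainder hpq r t
  refine ⟨w % (p * q), Nat.mod_lt _ (Nat.mul_pos (by omega) (by omega)), fun m => ?_⟩
  have h := Nat.modEq_and_modEq_iff_modEq_mul (a := m) (b := w) hpq
  unfold Nat.ModEq at *
  rw [← h, hw₁, hw₂, Nat.mod_eq_of_lt hr, Nat.mod_eq_of_lt ht]

theorem abs_sum_prod_residueComb_sub_le {ι : Type*} (b n : ι → ℕ) (g : ι → ℕ → ℝ) (δ : ι → ℝ)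
    (hcop : ∀ i j, i ≠ j → Nat.Coprime (b i) (b j))
    (hg : ∀ i, IsResidueComb (b i) (n i) (g i) (δ i)) (M : ℕ) (T : Finset ι) :
    ∀ q r : ℕ, r < q → (∀ i ∈ T, Nat.Coprime q (b i)) →
      |(∑ m ∈ Finset.range M, (if m % q = r then (1 : ℝ) else 0) * ∏ i ∈ T, g i m)
        - M * ((1 / q) * ∏ i ∈ T, δ i)| ≤ ((∏ i ∈ T, n i : ℕ) : ℝ) := by
  classical
  induction T using Finset.induction_on with
  | empty =>
    intro q r hr _
    simpa [div_eq_mul_inv] using abs_sum_mod_eq_sub_le_s11 q r M hr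
  | insert i T hi ih =>
    intro q r hr hq
    simp only [Finset.prod_insert hi]
    have hqT : ∀ j ∈ T, Nat.Coprime q (b j) := fun j hj => hq j (Finset.mem_insert_of_mem hj)
    have hqi := hq i (Finset.mem_insert_self i T)
    have main : ∀ n' g' δ', IsResidueComb (b i) n' g' δ' →
        |(∑ m ∈ Finset.range M, (if m % q = r then (1 : ℝ) else 0) * (g' m * ∏ j ∈ T, g j m))
          - M * ((1 / q) * (δ' * ∏ j ∈ T, δ j))| ≤ ((n' * ∏ j ∈ T, n j : ℕ) : ℝ) := by
      intro n' g' δ' h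
      induction h with
      | zero => simp
      | single k t ht =>
        obtain ⟨w, hw, hiff⟩ := exists_mod_mul_eq_iff (hqi.pow_right k) hr ht
        have h1 := ih (q * b i ^ k) w hw (fun j hj => Nat.Coprime.mul_left (hqT j hj)
          (Nat.Coprime.pow_left k (hcop i j (by rintro rfl; exact hi hj))))
        simp only [hiff] at h1
        rw [one_mul]
        refine le_of_eq_of_le ?_ h1
        congr 2
        · refine Finset.sum_congr rfl fun m _ => ?_
          by_cases ha : m % q = r <;> by_cases hb : m % b i ^ k = t <;> simp [ha, hb]
        · push_cast
          field_simp
      | add _ _ h h' =>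
        refine le_of_eq_of_le ?_ ((abs_add_le _ _).trans ((add_le_add h h').trans_eq ?_))
        · congr 1
          simp only [add_mul, mul_add, Finset.sum_add_distrib]
          ring
        · push_cast; ring
      | sub _ _ h h' =>
        refine le_of_eq_of_le ?_ ((abs_sub _ _).trans ((add_le_add h h').trans_eq ?_))
        · congr 1
          simp only [sub_mul, mul_sub, Finset.sum_sub_distrib]
          ring
        · push_cast; ring
      | mono hn _ h =>
        refine h.trans ?_
        exact_mod_cast Nat.mul_le_mul_right _ hn
    exact main _ _ _ (hg i)

theorem digitReverse_eq_iff (b : ℕ) (hb : 0 < b) (K : ℕ) :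
    ∀ c < b ^ K, ∃ r < b ^ K, ∀ m, digitReverse b K m = c ↔ m % b ^ K = r := by
  induction K with
  | zero =>
    intro c hc
    refine ⟨0, by simp, fun m => ?_⟩
    simp only [pow_zero, Nat.lt_one_iff] at hc
    simp [digitReverse, hc, Nat.mod_one]
  | succ K ih =>
    intro c hc
    have hP : 0 < b ^ K := pow_pos hb K
    obtain ⟨r, hr, h⟩ := ih (c / b) (by rw [Nat.div_lt_iff_lt_mul hb, ← pow_succ]; exact hc)
    have hd : c % b < b := Nat.mod_lt _ hb
    refine ⟨r + b ^ K * (c % b), ?_, fun m => ?_⟩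
    · rw [pow_succ]; nlinarith
    have hm : m / b ^ K % b < b := Nat.mod_lt _ hb
    have hm' : m % b ^ K < b ^ K := Nat.mod_lt _ hP
    have aux : ∀ {B x y x' y' : ℕ}, x < B → x' < B →
        (x + B * y = x' + B * y' ↔ x = x' ∧ y = y') := by
      intro B x y x' y' hx hx'
      have hB : 0 < B := by omega
      refine ⟨fun e => ?_, by rintro ⟨rfl, rfl⟩; rfl⟩
      have h1 := congrArg (· % B) e
      have h2 := congrArg (· / B) e
      simp only [Nat.add_mul_mod_self_left, Nat.mod_eq_of_lt hx, Nat.mod_eq_of_lt hx',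
        Nat.add_mul_div_left _ _ hB, Nat.div_eq_of_lt hx, Nat.div_eq_of_lt hx'] at h1 h2
      omega
    rw [Nat.mod_pow_succ, aux hm' hr, ← h, digitReverse]
    conv_lhs => rw [← Nat.mod_add_div c b, add_comm]
    rw [aux hm hd, and_comm]

theorem digitReverse_lt_isResidueComb (b : ℕ) (hb : 0 < b) (K : ℕ) :
    ∀ c ≤ b ^ K, IsResidueComb b (1 + b * K)
      (fun m => if digitReverse b K m < c then 1 else 0) (c / (b : ℝ) ^ K) := by
  induction K with
  | zero =>
    intro c hc
    simp only [pow_zero] at hc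
    interval_cases c
    · simpa using (IsResidueComb.zero (b := b)).mono (Nat.zero_le 1)
    · simpa [digitReverse, Nat.mod_one] using IsResidueComb.single (b := b) 0 0 (by simp)
  | succ K ih =>
    intro c hc
    have hb' : (b : ℝ) ≠ 0 := by exact_mod_cast hb.ne'
    have step : ∀ d ≤ b, ∀ c' ≤ b ^ K, b * c' + d ≤ b ^ (K + 1) →
        IsResidueComb b (1 + b * K + d)
          (fun m => if digitReverse b (K + 1) m < b * c' + d then 1 else 0)
          ((b * c' + d : ℕ) / (b : ℝ) ^ (K + 1)) := by
      intro d
      induction d with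
      | zero =>
        intro _ c' hc' _
        convert ih c' hc' using 1
        · rfl
        · funext m
          have hm : m / b ^ K % b < b := Nat.mod_lt _ hb
          have : digitReverse b (K + 1) m < b * c' + 0 ↔ digitReverse b K m < c' := by
            rw [digitReverse]
            constructor
            · intro h
              by_contra! h'
              have := Nat.mul_le_mul_left b h'
              omega
            · intro h
              have := Nat.mul_le_mul_left b (Nat.succ_le_of_lt h)
              rw [Nat.mul_succ] at this
              omega
          simp only [this]
        · rw [pow_succ']
          push_cast
          field_simp
          ring
      | succ d ihd =>
        intro hd c' hc' h
        obtain ⟨r, hr, hiff⟩ := digitReverse_eq_iff b hb (K + 1) (b * c' + d) (by omega)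
        convert (ihd (by omega) c' hc' (by omega)).add (IsResidueComb.single (K + 1) r hr) using 1
        · rfl
        · funext m
          rw [if_congr (hiff m).symm rfl rfl]
          rcases lt_trichotomy (digitReverse b (K + 1) m) (b * c' + d) with h | h | h
          · simp [h, h.ne, show digitReverse b (K + 1) m < b * c' + (d + 1) by omega]
          · simp [h]
          · simp [h.not_gt, h.ne', show ¬ digitReverse b (K + 1) m < b * c' + (d + 1) by omega]
        · push_cast
          ring
    have hd : c % b < b := Nat.mod_lt _ hb
    have := step (c % b) hd.le (c / b)
      (Nat.div_le_of_le_mul (by rwa [pow_succ'] at hc)) (by rwa [Nat.div_add_mod])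
    rw [Nat.div_add_mod] at this
    exact this.mono (by rw [Nat.mul_succ]; omega)

theorem radInv_eq_digitReverse (b : ℕ) (hb : 2 ≤ b) (K m : ℕ) (hm : m < b ^ K) :
    radInv b m = digitReverse b K m / (b : ℝ) ^ K := by
  have hb' : (b : ℝ) ≠ 0 := by positivity
  have h1 : radInv b m
      = ∑ j ∈ Finset.range K, ((m / b ^ j % b : ℕ) : ℝ) / (b : ℝ) ^ (j + 1) := by
    refine tsum_eq_sum fun j hj => ?_
    have : m / b ^ j = 0 := Nat.div_eq_of_lt
      (hm.trans_le (Nat.pow_le_pow_right (by omega) (by simpa using hj)))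
    simp [this]
  rw [h1]
  clear hm h1
  induction K with
  | zero => simp [digitReverse]
  | succ K ih =>
    rw [Finset.sum_range_succ, ih, digitReverse]
    push_cast
    field_simp
    ring

theorem abs_prod_sub_prod_le {ι : Type*} (T : Finset ι) (x y : ι → ℝ) (η : ℝ)
    (hx : ∀ i, 0 ≤ x i ∧ x i ≤ 1) (hy : ∀ i, 0 ≤ y i ∧ y i ≤ 1) (h : ∀ i, |x i - y i| ≤ η) :
    |∏ i ∈ T, x i - ∏ i ∈ T, y i| ≤ T.card * η := by
  classical
  induction T using Finset.induction_on with
  | empty => simp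
  | insert i T hi ih =>
    rw [Finset.prod_insert hi, Finset.prod_insert hi, Finset.card_insert_of_notMem hi]
    have hP : |∏ j ∈ T, y j| ≤ 1 := by
      rw [Finset.abs_prod]
      exact Finset.prod_le_one (fun j _ => abs_nonneg _)
        (fun j _ => by rw [abs_of_nonneg (hy j).1]; exact (hy j).2)
    have e : x i * ∏ j ∈ T, x j - y i * ∏ j ∈ T, y j
        = x i * (∏ j ∈ T, x j - ∏ j ∈ T, y j) + (x i - y i) * ∏ j ∈ T, y j := by ring
    rw [e]
    refine (abs_add_le _ _).trans ?_
    rw [abs_mul, abs_mul, abs_of_nonneg (hx i).1]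
    have h1 := mul_le_mul (hx i).2 ih (abs_nonneg _) zero_le_one
    have h2 := mul_le_mul (h i) hP (abs_nonneg _) ((abs_nonneg _).trans (h i))
    push_cast
    linarith

theorem halton_count_bound (s : ℕ) (b : Fin s → ℕ) (hb : ∀ i, 2 ≤ b i)
    (hcop : ∀ i j, i ≠ j → Nat.Coprime (b i) (b j)) (K M : ℕ) (hM : M ≤ 2 ^ K)
    (u v : Fin s → ℝ) (hu : ∀ i, 0 ≤ u i) (huv : ∀ i, u i ≤ v i) (hv : ∀ i, v i ≤ 1) :
    |(∑ m ∈ Finset.range M,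
        if ∀ i, radInv (b i) m ∈ Set.Ico (u i) (v i) then (1 : ℝ) else 0)
      - M * ∏ i, (v i - u i)| ≤ (∏ i, (2 * (1 + b i * K)) : ℕ) + s := by
  have hMb : ∀ i, M ≤ b i ^ K := fun i => hM.trans (Nat.pow_le_pow_left (hb i) K)
  have hB : ∀ i, (0 : ℝ) < (b i : ℝ) ^ K := fun i => by
    have := hb i
    positivity
  set c : Fin s → ℕ := fun i => ⌈u i * (b i : ℝ) ^ K⌉₊ with hc
  set d : Fin s → ℕ := fun i => ⌈v i * (b i : ℝ) ^ K⌉₊ with hd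
  have hcd : ∀ i, c i ≤ d i := fun i =>
    Nat.ceil_mono (mul_le_mul_of_nonneg_right (huv i) (hB i).le)
  have hdb : ∀ i, d i ≤ b i ^ K := fun i => by
    refine Nat.ceil_le.2 ?_
    push_cast
    nlinarith [hB i, hv i]
  have comb : ∀ i, IsResidueComb (b i) (2 * (1 + b i * K))
      (fun m => (if digitReverse (b i) K m < d i then 1 else 0)
        - (if digitReverse (b i) K m < c i then 1 else 0))
      (d i / (b i : ℝ) ^ K - c i / (b i : ℝ) ^ K) := fun i => by
    have hb0 : 0 < b i := by linarith [hb i]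
    rw [two_mul]
    exact (digitReverse_lt_isResidueComb (b i) hb0 K (d i) (hdb i)).sub
      (digitReverse_lt_isResidueComb (b i) hb0 K (c i) ((hcd i).trans (hdb i)))
  have key := abs_sum_prod_residueComb_sub_le b _ _ _ hcop comb M Finset.univ 1 0 one_pos
    (by simp)
  simp only [Nat.mod_one, if_true, one_mul, Nat.cast_one, div_one] at key
  have hsum : (∑ m ∈ Finset.range M,
        if ∀ i, radInv (b i) m ∈ Set.Ico (u i) (v i) then (1 : ℝ) else 0)
      = ∑ m ∈ Finset.range M, ∏ i, ((if digitReverse (b i) K m < d i then (1 : ℝ) else 0)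
        - (if digitReverse (b i) K m < c i then 1 else 0)) := by
    refine Finset.sum_congr rfl fun m hm => ?_
    have hm' : ∀ i, m < b i ^ K := fun i => (Finset.mem_range.1 hm).trans_le (hMb i)
    have hterm : ∀ i, ((if digitReverse (b i) K m < d i then (1 : ℝ) else 0)
        - (if digitReverse (b i) K m < c i then 1 else 0))
        = if radInv (b i) m ∈ Set.Ico (u i) (v i) then 1 else 0 := by
      intro i
      have hiff : radInv (b i) m ∈ Set.Ico (u i) (v i) ↔
          c i ≤ digitReverse (b i) K m ∧ digitReverse (b i) K m < d i := by
        rw [radInv_eq_digitReverse (b i) (hb i) K m (hm' i), Set.mem_Ico, le_div_iff₀ (hB i),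
          div_lt_iff₀ (hB i), hc, hd, Nat.ceil_le, Nat.lt_ceil]
      have := hcd i
      rw [if_congr hiff rfl rfl]
      split_ifs <;> first | omega | norm_num
    rw [Finset.prod_congr rfl fun i _ => hterm i, Finset.prod_ite_zero]
    simp
  have hvol := abs_prod_sub_prod_le Finset.univ
    (fun i => (d i / (b i : ℝ) ^ K - c i / (b i : ℝ) ^ K)) (fun i => v i - u i) (1 / (2 : ℝ) ^ K)
    (fun i => by
      rw [← sub_div]
      have h1 : (c i : ℝ) ≤ d i := by exact_mod_cast hcd i
      have h2 : (d i : ℝ) ≤ (b i : ℝ) ^ K := by exact_mod_cast hdb i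
      have h3 : (0 : ℝ) ≤ c i := by positivity
      exact ⟨div_nonneg (by linarith) (hB i).le, (div_le_one (hB i)).2 (by linarith)⟩)
    (fun i => ⟨by linarith [huv i], by linarith [hu i, hv i]⟩)
    (fun i => by
      have h1 := Nat.le_ceil (u i * (b i : ℝ) ^ K)
      have h2 := Nat.ceil_lt_add_one (mul_nonneg (hu i) (hB i).le)
      have h3 := Nat.le_ceil (v i * (b i : ℝ) ^ K)
      have h4 := Nat.ceil_lt_add_one (mul_nonneg ((hu i).trans (huv i)) (hB i).le)
      have h5 : (d i / (b i : ℝ) ^ K - c i / (b i : ℝ) ^ K) - (v i - u i)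
          = ((d i - v i * (b i : ℝ) ^ K) - (c i - u i * (b i : ℝ) ^ K)) / (b i : ℝ) ^ K := by
        have := (hB i).ne'
        field_simp
        ring
      rw [h5, abs_div, abs_of_pos (hB i)]
      refine div_le_div₀ zero_le_one ?_ (by positivity) ?_
      · rw [abs_le]; constructor <;> linarith
      · exact pow_le_pow_left₀ zero_le_two (by exact_mod_cast hb i) K)
  have hvol' : |(M : ℝ) * ∏ i, (d i / (b i : ℝ) ^ K - c i / (b i : ℝ) ^ K)
      - M * ∏ i, (v i - u i)| ≤ s := by
    rw [← mul_sub, abs_mul, abs_of_nonneg (Nat.cast_nonneg M)]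
    have hM' : (M : ℝ) ≤ 2 ^ K := by exact_mod_cast hM
    rw [Finset.card_univ, Fintype.card_fin] at hvol
    refine (mul_le_mul hM' hvol (abs_nonneg _) (by positivity)).trans_eq ?_
    field_simp
  rw [hsum]
  exact (abs_sub_le _ _ _).trans (add_le_add key hvol')

theorem halton_discrepancy (s : ℕ) (b : Fin s → ℕ) (hb : ∀ i, 2 ≤ b i)
    (hcop : ∀ i j, i ≠ j → Nat.Coprime (b i) (b j)) :
    ∃ D > (0 : ℝ), ∀ M : ℕ, 2 ≤ M →
      ∀ u v : Fin s → ℝ, (∀ i, 0 ≤ u i) → (∀ i, u i ≤ v i) → (∀ i, v i ≤ 1) →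
      |(∑ m ∈ Finset.range M,
          if ∀ i, radInv (b i) m ∈ Set.Ico (u i) (v i) then (1 : ℝ) else 0)
        - M * ∏ i, (v i - u i)| ≤ D * Real.log M ^ s + s := by
  have hl2 : 0 < Real.log 2 := Real.log_pos one_lt_two
  refine ⟨∏ i, (2 * ((1 + b i) * (2 / Real.log 2))), by positivity, fun M hM u v hu huv hv => ?_⟩
  have hK := halton_count_bound s b hb hcop (Nat.clog 2 M) M (Nat.le_pow_clog one_lt_two M)
    u v hu huv hv
  refine hK.trans (add_le_add ?_ le_rfl)
  set K := Nat.clog 2 M with hKdef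
  have hlog : Real.log 2 ≤ Real.log M :=
    Real.log_le_log two_pos (by exact_mod_cast hM)
  have hK1 : 1 ≤ K := Nat.clog_pos one_lt_two hM
  have hKlog : ((K : ℝ) - 1) * Real.log 2 ≤ Real.log M := by
    have h1 : 2 ^ (K - 1) < M := Nat.pow_pred_clog_lt_self one_lt_two hM
    have h2 : Real.log ((2 : ℝ) ^ (K - 1)) ≤ Real.log M :=
      Real.log_le_log (by positivity) (by exact_mod_cast h1.le)
    rwa [Real.log_pow, Nat.cast_sub hK1, Nat.cast_one] at h2
  have hKle : (K : ℝ) ≤ 2 / Real.log 2 * Real.log M := by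
    rw [div_mul_eq_mul_div, le_div_iff₀ hl2]
    linarith
  have hpow : Real.log M ^ s = ∏ _i : Fin s, Real.log M := by simp
  rw [hpow, ← Finset.prod_mul_distrib]
  push_cast
  refine Finset.prod_le_prod (fun i _ => by positivity) fun i _ => ?_
  have hK1' : (1 : ℝ) ≤ K := by exact_mod_cast hK1
  have h3 : (1 : ℝ) + b i * K ≤ (1 + b i) * K := by linarith
  have h4 : (1 + (b i : ℝ)) * K ≤ (1 + b i) * (2 / Real.log 2 * Real.log M) :=
    mul_le_mul_of_nonneg_left hKle (by positivity)
  linarith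

theorem sum_floor_mul_eq (γ : ℝ) (hγ : 0 < γ) (f : ℕ → ℝ) (M : ℕ) :
    ∑ n ∈ Finset.range ⌈(M : ℝ) / γ⌉₊, f ⌊(n : ℝ) * γ⌋₊
      = ∑ m ∈ Finset.range M, ((⌈((m + 1 : ℕ) : ℝ) / γ⌉₊ : ℝ) - ⌈(m : ℝ) / γ⌉₊) * f m := by
  induction M with
  | zero => simp
  | succ M ih =>
    have hle : ⌈(M : ℝ) / γ⌉₊ ≤ ⌈((M + 1 : ℕ) : ℝ) / γ⌉₊ := by
      refine Nat.ceil_mono (div_le_div_of_nonneg_right ?_ hγ.le)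
      push_cast
      linarith
    rw [Finset.sum_range_succ, ← ih, ← Finset.sum_range_add_sum_Ico _ hle]
    congr 1
    rw [Finset.sum_congr rfl (g := fun _ => f M), Finset.sum_const, Nat.card_Ico, nsmul_eq_mul,
      Nat.cast_sub hle]
    intro n hn
    rw [Finset.mem_Ico, Nat.ceil_le, Nat.lt_ceil, div_le_iff₀ hγ, lt_div_iff₀ hγ] at hn
    congr 1
    rw [Nat.floor_eq_iff (by positivity)]
    exact ⟨hn.1, by exact_mod_cast hn.2⟩

/-- The sequence `⌊nα⌋` with `1/α = 1 + 1/β` consists of all natural numbers together with the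
values of `⌊nβ⌋`. -/
theorem sum_floor_mul_split (α β : ℝ) (hβ : 0 < β) (hα : α = β / (β + 1)) (f : ℕ → ℝ) (M : ℕ) :
    ∑ n ∈ Finset.range (M + ⌈(M : ℝ) / β⌉₊), f ⌊(n : ℝ) * α⌋₊
      = ∑ m ∈ Finset.range M, f m + ∑ n ∈ Finset.range ⌈(M : ℝ) / β⌉₊, f ⌊(n : ℝ) * β⌋₊ := by
  have hα0 : 0 < α := by rw [hα]; positivity
  have hceil : ∀ m : ℕ, ⌈(m : ℝ) / α⌉₊ = m + ⌈(m : ℝ) / β⌉₊ := fun m => by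
    have : (m : ℝ) / α = (m : ℝ) / β + m := by
      rw [hα]
      field_simp
      ring
    rw [this, Nat.ceil_add_natCast (by positivity), add_comm]
  rw [← hceil, sum_floor_mul_eq α hα0, sum_floor_mul_eq β hβ, ← Finset.sum_add_distrib]
  refine Finset.sum_congr rfl fun m _ => ?_
  rw [hceil, hceil]
  push_cast
  ring

theorem abs_sum_Icc_sub_sum_range_le (f : ℕ → ℝ) (hf : ∀ n, 0 ≤ f n ∧ f n ≤ 1) (N : ℕ) :
    |∑ n ∈ Finset.Icc 1 N, f n - ∑ n ∈ Finset.range N, f n| ≤ 1 := by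
  have h : ∑ n ∈ Finset.Icc 1 N, f n - ∑ n ∈ Finset.range N, f n = f N - f 0 := by
    induction N with
    | zero => simp
    | succ N ih =>
      rw [Finset.sum_Icc_succ_top (by omega), Finset.sum_range_succ]
      linarith
  rw [h, abs_le]
  constructor <;> linarith [(hf N).1, (hf N).2, (hf 0).1, (hf 0).2]

/-- If the sequence `y_n = (φ_{b_1}(⌊nα⌋),…,φ_{b_s}(⌊nα⌋))`, `n ≥ 1`, with `α = β/(β+1)`,
satisfies `N·D_N ≤ C (log N)^{s+1+ε}` for all `ε > 0`, then so does
`x_n = (φ_{b_1}(⌊nβ⌋),…,φ_{b_s}(⌊nβ⌋))`, `n ≥ 1` (with another constant `C'`).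
The discrepancy bounds are stated pointwise over all half-open boxes `∏ [u i, v i)`. -/
theorem stmt11 (s : ℕ) (hs : 1 ≤ s) (b : Fin s → ℕ) (hb : ∀ i, 2 ≤ b i)
    (hcop : ∀ i j, i ≠ j → Nat.Coprime (b i) (b j))
    (β : ℝ) (hβ : 1 < β) (α : ℝ) (hα : α = β / (β + 1))
    (H : ∀ ε > (0 : ℝ), ∃ C > (0 : ℝ), ∀ N : ℕ, 2 ≤ N →
      ∀ u v : Fin s → ℝ, (∀ i, 0 ≤ u i) → (∀ i, u i ≤ v i) → (∀ i, v i ≤ 1) →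
        |(((Finset.Icc 1 N).filter
            (fun n => ∀ i, radInv (b i) (⌊(n : ℝ) * α⌋.toNat) ∈ Set.Ico (u i) (v i))).card : ℝ)
          - N * ∏ i, (v i - u i)| ≤ C * Real.log N ^ ((s : ℝ) + 1 + ε)) :
    ∀ ε > (0 : ℝ), ∃ C' > (0 : ℝ), ∀ N : ℕ, 2 ≤ N →
      ∀ u v : Fin s → ℝ, (∀ i, 0 ≤ u i) → (∀ i, u i ≤ v i) → (∀ i, v i ≤ 1) →
        |(((Finset.Icc 1 N).filter
            (fun n => ∀ i, radInv (b i) (⌊(n : ℝ) * β⌋.toNat) ∈ Set.Ico (u i) (v i))).card : ℝ)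
          - N * ∏ i, (v i - u i)| ≤ C' * Real.log N ^ ((s : ℝ) + 1 + ε) := by
  intro ε hε
  obtain ⟨C, hC, hCN⟩ := H ε hε
  obtain ⟨D, hD, hDM⟩ := halton_discrepancy s b hb hcop
  have hβ0 : 0 < β := by linarith
  have hl2 : 0 < Real.log 2 := Real.log_pos one_lt_two
  set e : ℝ := (s : ℝ) + 1 + ε with he
  have he0 : 0 < e := by positivity
  set L : ℝ := 1 + Real.log (β + 2) / Real.log 2 with hL
  have hlβ : 1 ≤ Real.log (β + 2) := by
    rw [Real.le_log_iff_exp_le (by linarith)]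
    linarith [Real.exp_one_lt_d9]
  have hL0 : 0 < L := by positivity
  refine ⟨(C + D + s + 4) * L ^ e, by positivity, fun N hN u v hu huv hv => ?_⟩
  set M : ℕ := ⌈(N : ℝ) * β⌉₊ with hM
  set N₀ : ℕ := ⌈(M : ℝ) / β⌉₊ with hN₀
  have hNr : (2 : ℝ) ≤ N := by exact_mod_cast hN
  have hMge : (N : ℝ) * β ≤ M := Nat.le_ceil _
  have hMlt : (M : ℝ) < N * β + 1 := Nat.ceil_lt_add_one (by positivity)
  have hN₀ge : N ≤ N₀ := by
    have : (N : ℝ) ≤ N₀ := ((le_div_iff₀ hβ0).2 hMge).trans (Nat.le_ceil _)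
    exact_mod_cast this
  have hN₀le : N₀ ≤ N + 1 := by
    refine Nat.ceil_le.2 ((div_le_iff₀ hβ0).2 ?_)
    push_cast
    linarith
  have hM2 : 2 ≤ M := by
    have : (2 : ℝ) ≤ M := by nlinarith
    exact_mod_cast this
  set t : ℝ := Real.log ((β + 2) * N) with ht
  have htsum : t = Real.log (β + 2) + Real.log N := Real.log_mul (by linarith) (by linarith)
  have hlN : Real.log 2 ≤ Real.log N := Real.log_le_log two_pos hNr
  have ht1 : 1 ≤ t := by linarith
  have htL : t ≤ L * Real.log N := by
    have : Real.log (β + 2) ≤ Real.log (β + 2) / Real.log 2 * Real.log N := by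
      rw [div_mul_eq_mul_div, le_div_iff₀ hl2]
      exact mul_le_mul_of_nonneg_left hlN (by linarith)
    rw [htsum, hL]
    linarith
  have hte1 : 1 ≤ t ^ e := Real.one_le_rpow ht1 he0.le
  have hteL : t ^ e ≤ L ^ e * Real.log N ^ e := by
    rw [← Real.mul_rpow hL0.le (by linarith)]
    exact Real.rpow_le_rpow (by linarith) htL he0.le
  have hN₀r : (N₀ : ℝ) ≤ N + 1 := by exact_mod_cast hN₀le
  have hlogM : Real.log M ≤ t :=
    Real.log_le_log (by exact_mod_cast (by omega : 0 < M)) (by nlinarith)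
  have hlogM0 : 0 ≤ Real.log M := Real.log_natCast_nonneg M
  have hlogA : Real.log (M + N₀ : ℕ) ≤ t := by
    refine Real.log_le_log (by exact_mod_cast (by omega : 0 < M + N₀)) ?_
    push_cast
    linarith
  have hMs : Real.log M ^ s ≤ t ^ e := by
    refine (pow_le_pow_left₀ hlogM0 hlogM s).trans ?_
    rw [← Real.rpow_natCast]
    exact Real.rpow_le_rpow_of_exponent_le ht1 (by linarith)
  have hAe : Real.log (M + N₀ : ℕ) ^ e ≤ t ^ e :=
    Real.rpow_le_rpow (Real.log_natCast_nonneg _) hlogA he0.le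
  set f : ℕ → ℝ := fun m =>
    if ∀ i, radInv (b i) m ∈ Set.Ico (u i) (v i) then (1 : ℝ) else 0 with hf
  have hf01 : ∀ m, 0 ≤ f m ∧ f m ≤ 1 := fun m => by
    rw [hf]
    dsimp only
    split_ifs <;> norm_num
  have hcard : ∀ (γ : ℝ) (P : ℕ), (((Finset.Icc 1 P).filter
      (fun n => ∀ i, radInv (b i) (⌊(n : ℝ) * γ⌋.toNat) ∈ Set.Ico (u i) (v i))).card : ℝ)
      = ∑ n ∈ Finset.Icc 1 P, f ⌊(n : ℝ) * γ⌋₊ := fun γ P => by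
    have himage : (do let a ← Finset.Icc 1 P; pure (a : ℝ) : Finset ℝ)
        = (Finset.Icc 1 P).image (fun a : ℕ => (a : ℝ)) := by
      simp only [Finset.bind_def, Finset.pure_def, Finset.sup_singleton_apply]
    rw [himage, Finset.filter_image, Finset.card_image_of_injective _ Nat.cast_injective]
    simp only [Int.floor_toNat, hf, Finset.sum_boole]
    congr!
  have hA := hCN (M + N₀) (by omega) u v hu huv hv
  have hH := hDM M hM2 u v hu huv hv
  rw [hcard] at hA ⊢
  change |∑ m ∈ Finset.range M, f m - _| ≤ _ at hH
  have hsplit := sum_floor_mul_split α β hβ0 hα f M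
  rw [← hN₀] at hsplit
  have hshiftα := abs_sum_Icc_sub_sum_range_le (fun n => f ⌊(n : ℝ) * α⌋₊) (fun n => hf01 _)
    (M + N₀)
  have hshiftβ := abs_sum_Icc_sub_sum_range_le (fun n => f ⌊(n : ℝ) * β⌋₊) (fun n => hf01 _) N
  set V : ℝ := ∏ i, (v i - u i) with hV
  have hV0 : 0 ≤ V := Finset.prod_nonneg fun i _ => by linarith [huv i]
  have hV1 : V ≤ 1 := Finset.prod_le_one (fun i _ => by linarith [huv i])
    (fun i _ => by linarith [hu i, hv i])
  have hextra : |(∑ n ∈ Finset.range N₀, f ⌊(n : ℝ) * β⌋₊ - N₀ * V)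
      - (∑ n ∈ Finset.range N, f ⌊(n : ℝ) * β⌋₊ - N * V)| ≤ 1 := by
    obtain h | h : N₀ = N ∨ N₀ = N + 1 := by omega
    · simp [h]
    · rw [h, Finset.sum_range_succ]
      push_cast
      have := hf01 ⌊(N : ℝ) * β⌋₊
      rw [abs_le]
      constructor <;> linarith
  have hbound : C * Real.log (M + N₀ : ℕ) ^ e + (D * Real.log M ^ s + s) + 3
      ≤ (C + D + s + 4) * L ^ e * Real.log N ^ e := by
    have h1 := mul_le_mul_of_nonneg_left hAe hC.le
    have h2 := mul_le_mul_of_nonneg_left hMs hD.le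
    have h3 := mul_le_mul_of_nonneg_left hte1 (Nat.cast_nonneg (α := ℝ) s)
    have h4 := mul_le_mul_of_nonneg_left hteL (show 0 ≤ C + D + s + 4 by positivity)
    linarith
  refine le_trans ?_ hbound
  push_cast at hA ⊢
  rw [abs_le] at *
  constructor <;> linarith [hA.1, hA.2, hH.1, hH.2]
end
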